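/- arXiv:2211.06810 — 2 statements merged into one kernel-verified Lean document; each statement's English description precedes it below -/
import Mathlib

section
/- If P is a rational polytope in R^d, then the lattice-point counting function i(P,t) = |Z^d ∩ tP| (for nonnegative integers t) is a quasi-polynomial in t whose period divides the denominator of P, i.e. the least common multiple of the denominators of the coordinates of the vertices of P. In particular, if P is an integral polytope, then i(P,t) is a polynomial in t. -/
/-!
STATEMENT 1: If P is a rational polytope in R^d, then the lattice-point counting function
i(P,t) = |Z^d ∩ tP| (for nonnegative integers t) is a quasi-polynomial in t whose period
divides the denominator of P, i.e. the least common multiple of the denominators of the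
coordinates of the vertices of P.  In particular, if P is an integral polytope, then
i(P,t) is a polynomial in t.

A polytope is encoded as the convex hull of a finite set of points; its vertices are its
extreme points.  "The period divides the denominator of P" is expressed equivalently as:
every positive common denominator D of the coordinates of the vertices of P is a period of
the quasi-polynomial (the denominator of P is the least such D, and the set of periods of a
periodic function on the integers is closed under divisors of any of its members).
-/

open Pointwise

/-- The Ehrhart counting function `i(P,t) = |Z^d ∩ tP|`, the number of lattice points in
the `t`-th dilate `tP = {tx : x ∈ P}` of `P`. -/
noncomputable def ehrhart {d : ℕ} (P : Set (Fin d → ℝ)) (t : ℕ) : ℕ :=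
  Set.ncard {z : Fin d → ℤ | (fun i => (z i : ℝ)) ∈ (t : ℝ) • P}

/-- The first nonzero coordinate of `r` is negative. -/
def LexNeg {n : ℕ} (r : Fin n → ℝ) : Prop :=
  ∃ i, (∀ j < i, r j = 0) ∧ r i < 0

lemma LexNeg.not_neg {n : ℕ} {r : Fin n → ℝ} (h : LexNeg r) : ¬ LexNeg (-r) := by
  rintro ⟨j, hj, hj'⟩
  obtain ⟨i, hi, hi'⟩ := h
  simp only [Pi.neg_apply, neg_eq_zero, Left.neg_neg_iff] at hj hj'
  rcases lt_trichotomy i j with h | rfl | h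
  · linarith [hj i h]
  · linarith
  · linarith [hi j h]

lemma LexNeg.of_smul {n : ℕ} {r : Fin n → ℝ} {ε : ℝ} (hε : 0 < ε) (h : LexNeg (ε • r)) :
    LexNeg r := by
  obtain ⟨i, hi, hi'⟩ := h
  simp only [Pi.smul_apply, smul_eq_mul, mul_eq_zero, hε.ne', false_or] at hi hi'
  exact ⟨i, hi, by simpa using (pos_iff_neg_of_mul_neg hi').mp hε⟩

/-- A nonempty compact set of vectors has a lexicographically greatest element. -/
lemma IsCompact.exists_lex_greatest {n : ℕ} {F : Set (Fin n → ℝ)} (hF : IsCompact F)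
    (hne : F.Nonempty) : ∃ c ∈ F, ∀ c' ∈ F, c' ≠ c → LexNeg (c' - c) := by
  induction n with
  | zero =>
    obtain ⟨c, hc⟩ := hne
    exact ⟨c, hc, fun c' _ h => absurd (Subsingleton.elim c' c) h⟩
  | succ n ih =>
    obtain ⟨b, hb, hmax⟩ := hF.exists_isMaxOn hne (continuous_apply 0).continuousOn
    have hF' : IsCompact (F ∩ {c | c 0 = b 0}) :=
      hF.inter_right (isClosed_eq (continuous_apply 0) continuous_const)
    obtain ⟨-, ⟨c, ⟨hcF, hc0⟩, rfl⟩, hgt⟩ := ih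
      (hF'.image (f := Fin.tail) (continuous_pi fun i => continuous_apply i.succ))
      (Set.Nonempty.image _ ⟨b, hb, rfl⟩)
    refine ⟨c, hcF, fun c' hc' hne => ?_⟩
    rcases (show c' 0 ≤ b 0 from hmax hc').lt_or_eq with h | h
    · exact ⟨0, by simp, by simp_all⟩
    · obtain ⟨i, hi, hi'⟩ := hgt (Fin.tail c') ⟨c', ⟨hc', h⟩, rfl⟩ fun htail => hne <| by
        rw [← Fin.cons_self_tail c', ← Fin.cons_self_tail c, htail, h, hc0]
      refine ⟨i.succ, fun j hj => ?_, hi'⟩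
      induction j using Fin.cases with
      | zero => simp_all
      | succ j => exact hi j (by simpa using hj)

/-- `S` is a lexicographic cell of `K` if nonzero vectors of `K` that are nonnegative off `S`
are lexicographically negative. Such `S` are the faces of a placing triangulation of the vector
configuration with space of linear relations `K`. -/
def IsLexCell {n : ℕ} (K : Submodule ℝ (Fin n → ℝ)) (S : Set (Fin n)) : Prop :=
  ∀ r ∈ K, r ≠ 0 → (∀ i ∉ S, 0 ≤ r i) → LexNeg r

lemma IsLexCell.of_subset_insert_zero {n : ℕ} {K : Submodule ℝ (Fin (n + 1) → ℝ)}
    {S T : Set (Fin (n + 1))} (hS : IsLexCell K S) (hT : ∀ i ∈ T, i ≠ 0 → i ∈ S) :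
    IsLexCell K T := by
  intro r hr hr0 hpos
  by_cases h0 : r 0 < 0
  · exact ⟨0, by simp, h0⟩
  · refine hS r hr hr0 fun i hi => ?_
    by_cases hi0 : i = 0
    · subst hi0; exact not_lt.mp h0
    · exact hpos i fun hiT => hi (hT i hiT hi0)

/-- Every fibre of the quotient by `K` has at most one nonnegative element supported on a cell. -/
lemma IsLexCell.eq_of_sub_mem {n : ℕ} {K : Submodule ℝ (Fin n → ℝ)} {c c' : Fin n → ℝ}
    (hc : 0 ≤ c) (hc' : 0 ≤ c') (hS : IsLexCell K c.support) (hS' : IsLexCell K c'.support)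
    (h : c' - c ∈ K) : c' = c := by
  by_contra hne
  refine (hS _ h (sub_ne_zero.mpr hne) fun i hi => ?_).not_neg
    (hS' _ (K.neg_mem h) (neg_ne_zero.mpr (sub_ne_zero.mpr hne)) fun i hi => ?_)
  · simpa [Function.notMem_support.mp hi] using hc' i
  · simpa [Function.notMem_support.mp hi] using hc i

/-- Every fibre of the quotient by `K` which meets the nonnegative orthant in a compact set has a
nonnegative element supported on a cell. -/
lemma exists_isLexCell_support {n : ℕ} {K : Submodule ℝ (Fin n → ℝ)} {b : Fin n → ℝ}
    (hb : 0 ≤ b) (hcomp : IsCompact {c | 0 ≤ c ∧ c - b ∈ K}) :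
    ∃ c, 0 ≤ c ∧ c - b ∈ K ∧ IsLexCell K c.support := by
  obtain ⟨c, ⟨hc, hcb⟩, hmax⟩ := hcomp.exists_lex_greatest ⟨b, hb, by simp⟩
  refine ⟨c, hc, hcb, fun r hr hr0 hpos => ?_⟩
  have key : ∀ i, ∀ᶠ ε : ℝ in nhdsWithin 0 (Set.Ioi 0), 0 ≤ c i + ε * r i := by
    intro i
    by_cases hi : c i = 0
    · filter_upwards [self_mem_nhdsWithin] with ε hε
      have := hpos i (by simpa using hi)
      have : 0 < ε := hε
      rw [hi]; positivity
    · have hci : 0 < c i := lt_of_le_of_ne (hc i) (Ne.symm hi)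
      have : Filter.Tendsto (fun ε : ℝ => c i + ε * r i) (nhds 0) (nhds (c i + 0 * r i)) :=
        Continuous.tendsto (by fun_prop) 0
      rw [zero_mul, add_zero] at this
      exact ((this.eventually (lt_mem_nhds hci)).filter_mono nhdsWithin_le_nhds).mono
        fun _ h => h.le
  obtain ⟨ε, hε, hε0⟩ := ((Filter.eventually_all.mpr key).and self_mem_nhdsWithin).exists
  have hε0 : 0 < ε := hε0
  have := hmax (c + ε • r) ⟨fun i => hε i, by
    rw [add_sub_right_comm]; exact K.add_mem hcb (K.smul_mem _ hr)⟩ (by simp [hr0, hε0.ne'])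
  rw [add_sub_cancel_left] at this
  exact this.of_smul hε0

/-- The number of ways to write `N` as a sum of `k + 1` natural numbers. -/
lemma ncard_natural_sums {ι : Type*} [Fintype ι] {S : Finset ι} {k : ℕ} (hS : S.card = k + 1)
    (N : ℕ) :
    {f : ι → ℕ | (∀ i, f i ≠ 0 → i ∈ S) ∧ ∑ i, f i = N}.ncard = (N + k).choose k := by
  classical
  have h : {f : ι → ℕ | (∀ i, f i ≠ 0 → i ∈ S) ∧ ∑ i, f i = N} =
      (fun f : ι →₀ ℕ => (f : ι → ℕ)) '' (S.finsuppAntidiag N : Set (ι →₀ ℕ)) := by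
    ext f
    simp only [Set.mem_ofPred_eq, Set.mem_image, Finset.mem_coe, Finset.mem_finsuppAntidiag]
    constructor
    · rintro ⟨hf, hN⟩
      refine ⟨Finsupp.equivFunOnFinite.symm f, ⟨?_, ?_⟩, by simp⟩
      · rw [← hN]
        exact Finset.sum_subset (Finset.subset_univ _) fun i _ hi => by
          by_contra h; exact hi (hf i h)
      · intro i hi
        exact hf i (by simpa using hi)
    · rintro ⟨g, ⟨hN, hg⟩, rfl⟩
      refine ⟨fun i hi => hg (by simpa using hi), ?_⟩
      rw [← hN]
      exact (Finset.sum_subset (Finset.subset_univ _) fun i _ hi => by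
          by_contra h; exact hi (hg (by simpa using h))).symm
  rw [h, Set.ncard_image_of_injective _ DFunLike.coe_injective, Set.ncard_coe_finset,
    Finset.card_finsuppAntidiag_nat_eq_choose, hS, show k + 1 + N - 1 = N + k by omega]
  exact Nat.choose_symm_add

/-- The counting function of a shifted free monoid on `k + 1` generators of degree `D` is given by
one polynomial on each residue class mod `D`, provided the shift is less than `D * (k + 1)`. -/
lemma exists_quasiPolynomial_choose {D h k : ℕ} [NeZero D] (hk : h < D * (k + 1)) :
    ∃ p : ZMod D → Polynomial ℝ, ∀ t : ℕ,
      ((∀ N, h + D * N = t → (p t).eval (t : ℝ) = (N + k).choose k) ∧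
        ((∀ N, h + D * N ≠ t) → (p t).eval (t : ℝ) = 0)) := by
  classical
  have hD : 0 < D := NeZero.pos D
  have hD' : (D : ℝ) ≠ 0 := by positivity
  let q : Polynomial ℝ := (Polynomial.preHilbertPoly ℝ k 0).comp
    (Polynomial.C (D : ℝ)⁻¹ * (Polynomial.X - Polynomial.C (h : ℝ)))
  have hq : ∀ x : ℝ, q.eval x = (Polynomial.preHilbertPoly ℝ k 0).eval ((D : ℝ)⁻¹ * (x - h)) := by
    intro x; simp [q]
  refine ⟨fun r => if r = (h : ZMod D) then q else 0, fun t => ⟨?_, ?_⟩⟩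
  · rintro N rfl
    have : (D : ℝ)⁻¹ * (((h + D * N : ℕ) : ℝ) - h) = (N : ℝ) := by
      push_cast; field_simp; ring
    simp only [Nat.cast_add, Nat.cast_mul, CharP.cast_eq_zero, zero_mul, add_zero, if_true]
    push_cast at this
    rw [hq, this, Polynomial.preHilbertPoly_eq_choose_sub_add ℝ k (Nat.zero_le N)]
    simp
  · intro hN
    beta_reduce
    split_ifs with hth
    · have hmod : h ≡ t [MOD D] := ((ZMod.natCast_eq_natCast_iff _ _ _).mp hth).symm
      rcases le_or_gt h t with hle | hlt
      · obtain ⟨N, hN'⟩ := (Nat.modEq_iff_dvd' hle).mp hmod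
        exact absurd (by omega) (hN N)
      · obtain ⟨s, hs⟩ := (Nat.modEq_iff_dvd' hlt.le).mp hmod.symm
        have hh : h = t + D * s := by omega
        have hs0 : s ≠ 0 := by rintro rfl; omega
        have hsk : s < k + 1 := lt_of_mul_lt_mul_left (by omega : D * s < D * (k + 1)) hD.le
        obtain ⟨u, rfl⟩ := Nat.exists_eq_succ_of_ne_zero hs0
        have : (D : ℝ)⁻¹ * ((t : ℝ) - h) = -((u + 1 : ℕ) : ℝ) := by
          rw [hh]; push_cast; field_simp; ring
        rw [hq, this, Polynomial.preHilbertPoly]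
        have := ascPochhammer_eval_neg_coe_nat_of_lt (R := ℝ) (n := k) (k := u) (by omega)
        simp [this]
    · simp

/-- The nonnegative points of `Λ` of degree `t` supported on a lexicographic cell of `K`. -/
def cellPoints {n : ℕ} (K : Submodule ℝ (Fin n → ℝ)) (Λ : AddSubgroup (Fin n → ℝ)) (D t : ℕ) :
    Set (Fin n → ℝ) :=
  {c | 0 ≤ c ∧ IsLexCell K c.support ∧ c ∈ Λ ∧ (D : ℝ) * ∑ i, c i = t}

/-- The part of a nonnegative vector that is removed to bring its zeroth coordinate into `[0, 1)`
and the other nonzero coordinates into `(0, 1]`. -/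
noncomputable def integerPart {m : ℕ} (c : Fin (m + 1) → ℝ) (i : Fin (m + 1)) : ℕ :=
  if i = 0 then ⌊c i⌋₊ else ⌈c i⌉₊ - 1

lemma integerPart_add {m : ℕ} {w : Fin (m + 1) → ℝ} (hw : 0 ≤ w) (hw0 : w 0 < 1)
    (hw1 : ∀ i, w i ≤ 1) {f : Fin (m + 1) → ℕ} (hf : ∀ i, f i ≠ 0 → i = 0 ∨ w i ≠ 0) :
    integerPart (fun i => w i + f i) = f := by
  ext i
  unfold integerPart
  split_ifs with hi
  · subst hi
    rw [Nat.floor_add_natCast (hw 0), Nat.floor_eq_zero.mpr hw0, zero_add]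
  · by_cases hwi : w i = 0
    · have : f i = 0 := by by_contra h; exact (hf i h).elim hi (fun h => h hwi)
      simp [hwi, this]
    · have hpos : 0 < w i := lt_of_le_of_ne (hw i) (Ne.symm hwi)
      have : ⌈w i⌉₊ = 1 :=
        (Nat.ceil_eq_iff one_ne_zero).mpr ⟨by simpa using hpos, by simpa using hw1 i⟩
      rw [Nat.ceil_add_natCast (hw i), this]; omega

lemma integerPart_le {m : ℕ} {c : Fin (m + 1) → ℝ} (hc : 0 ≤ c) (i : Fin (m + 1)) :
    (integerPart c i : ℝ) ≤ c i := by
  unfold integerPart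
  split_ifs with hi
  · exact Nat.floor_le (hc i)
  · rcases Nat.eq_zero_or_pos ⌈c i⌉₊ with h | h
    · simpa [h] using hc i
    · exact (Nat.lt_ceil.mp (Nat.sub_lt h one_pos)).le

lemma integerPart_lt {m : ℕ} {c : Fin (m + 1) → ℝ} {i : Fin (m + 1)} (hi : i ≠ 0)
    (hc : 0 < c i) : (integerPart c i : ℝ) < c i := by
  rw [integerPart, if_neg hi]
  exact Nat.lt_ceil.mp (Nat.sub_lt (Nat.ceil_pos.mpr hc) one_pos)

lemma sub_integerPart_le_one {m : ℕ} (c : Fin (m + 1) → ℝ) (i : Fin (m + 1)) :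
    c i - integerPart c i ≤ 1 := by
  unfold integerPart
  split_ifs with hi
  · linarith [Nat.lt_floor_add_one (c i)]
  · have h1 : ⌈c i⌉₊ ≤ (⌈c i⌉₊ - 1) + 1 := by omega
    have h2 : (⌈c i⌉₊ : ℝ) ≤ ((⌈c i⌉₊ - 1 : ℕ) : ℝ) + 1 := by exact_mod_cast h1
    linarith [Nat.le_ceil (c i)]

lemma sub_integerPart_zero_lt_one {m : ℕ} (c : Fin (m + 1) → ℝ) : c 0 - integerPart c 0 < 1 := by
  rw [integerPart, if_pos rfl]
  linarith [Nat.lt_floor_add_one (c 0)]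

/-- The points of `cellPoints K Λ D t` lie in translates of free monoids by the points in a box. -/
lemma exists_quasiPolynomial_ncard_cellPoints {m D : ℕ} [NeZero D]
    {K : Submodule ℝ (Fin (m + 1) → ℝ)} {Λ : AddSubgroup (Fin (m + 1) → ℝ)}
    (hΛ : ∀ f : Fin (m + 1) → ℕ, (fun i => (f i : ℝ)) ∈ Λ)
    (hdeg : ∀ c ∈ Λ, ∃ z : ℤ, (D : ℝ) * ∑ i, c i = z)
    (hfin : ∀ t, (cellPoints K Λ D t).Finite) :
    ∃ p : ZMod D → Polynomial ℝ, ∀ t : ℕ,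
      ((cellPoints K Λ D t).ncard : ℝ) = (p t).eval (t : ℝ) := by
  classical
  have hD : 0 < D := NeZero.pos D
  have hD' : (0 : ℝ) < D := by positivity
  let B : Set (Fin (m + 1) → ℝ) :=
    {w | 0 ≤ w ∧ IsLexCell K w.support ∧ w ∈ Λ ∧ w 0 < 1 ∧ ∀ i, w i ≤ 1}
  have hdegB : ∀ w ∈ B, ∃ h : ℕ, (D : ℝ) * ∑ i, w i = h := by
    rintro w ⟨hw, -, hwΛ, -⟩
    obtain ⟨z, hz⟩ := hdeg w hwΛ
    have : 0 ≤ (z : ℝ) := hz ▸ mul_nonneg hD'.le (Finset.sum_nonneg fun i _ => hw i)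
    lift z to ℕ using (by exact_mod_cast this)
    exact ⟨z, by simpa using hz⟩
  have hB : B.Finite := by
    refine ((Set.finite_Iic (D * (m + 1))).biUnion fun t _ => hfin t).subset fun w hw => ?_
    obtain ⟨h, hh⟩ := hdegB w hw
    obtain ⟨hw0, hS, hwΛ, -, hw1⟩ := hw
    refine Set.mem_biUnion (x := h) ?_ ⟨hw0, hS, hwΛ, hh⟩
    have : (h : ℝ) ≤ D * (m + 1) := by
      rw [← hh]
      gcongr
      calc ∑ i, w i ≤ ∑ i : Fin (m + 1), (1 : ℝ) := Finset.sum_le_sum fun i _ => hw1 i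
        _ = m + 1 := by simp
    rw [Set.mem_Iic]
    exact_mod_cast this
  have hquasi : ∀ w ∈ B, ∃ p : ZMod D → Polynomial ℝ, ∀ t : ℕ,
      ({f : Fin (m + 1) → ℕ | (∀ i, f i ≠ 0 → i = 0 ∨ w i ≠ 0) ∧
        (D : ℝ) * ∑ i, (w i + f i) = t}.ncard : ℝ) = (p t).eval (t : ℝ) := by
    intro w hw
    obtain ⟨h, hh⟩ := hdegB w hw
    obtain ⟨hw0, hS, hwΛ, hwlt, hw1⟩ := hw
    let T : Finset (Fin (m + 1)) := {i | i = 0 ∨ w i ≠ 0}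
    have h0T : (0 : Fin (m + 1)) ∈ T := by simp [T]
    obtain ⟨k, hk⟩ : ∃ k, T.card = k + 1 :=
      Nat.exists_eq_succ_of_ne_zero (Finset.card_ne_zero_of_mem h0T)
    have hlt : h < D * (k + 1) := by
      have : (h : ℝ) < D * (k + 1) := by
        rw [← hh]
        gcongr
        calc ∑ i, w i = ∑ i ∈ T, w i :=
              (Finset.sum_subset (Finset.subset_univ _) fun i _ hi => by
                by_contra h; exact hi (by simp [T, h])).symm
          _ < ∑ i ∈ T, (1 : ℝ) := Finset.sum_lt_sum (fun i _ => hw1 i) ⟨0, h0T, hwlt⟩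
          _ = k + 1 := by simp [hk]
      exact_mod_cast this
    obtain ⟨p, hp⟩ := exists_quasiPolynomial_choose hlt
    refine ⟨p, fun t => ?_⟩
    have hiff : ∀ f : Fin (m + 1) → ℕ,
        (D : ℝ) * ∑ i, (w i + f i) = t ↔ h + D * ∑ i, f i = t := by
      intro f
      rw [Finset.sum_add_distrib, mul_add, hh]
      norm_cast
    simp only [hiff]
    by_cases hN : ∃ N, h + D * N = t
    · obtain ⟨N, hN⟩ := hN
      rw [(hp t).1 N hN, ← ncard_natural_sums hk N]
      congr 2
      ext f
      have : h + D * ∑ i, f i = t ↔ ∑ i, f i = N := by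
        rw [← hN, Nat.add_left_cancel_iff, Nat.mul_right_inj hD.ne']
      simp [T, this]
    · push Not at hN
      rw [(hp t).2 hN]
      simp [hN]
  choose! p hp using hquasi
  refine ⟨fun r => ∑ w ∈ hB.toFinset, p w r, fun t => ?_⟩
  rw [Polynomial.eval_finsetSum, Set.ncard_eq_toFinset_card _ (hfin t),
    Finset.card_eq_sum_card_fiberwise (f := fun c i => c i - integerPart c i)
      (t := hB.toFinset), Nat.cast_sum]
  · refine Finset.sum_congr rfl fun w hw => ?_
    rw [Set.Finite.mem_toFinset] at hw
    rw [← hp w hw t]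
    obtain ⟨hw0, hS, hwΛ, hwlt, hw1⟩ := hw
    rw [← Set.ncard_image_of_injective _ (f := fun (f : Fin (m + 1) → ℕ) i => w i + f i)
      (fun f g hfg => funext fun i => by simpa using congrFun hfg i), ← Set.ncard_coe_finset]
    congr 2
    ext c
    simp only [Finset.coe_filter, Set.Finite.mem_toFinset, Set.mem_ofPred_eq, Set.mem_image]
    constructor
    · rintro ⟨⟨hc, hcS, hcΛ, hct⟩, rfl⟩
      refine ⟨integerPart c, ⟨fun i hi => ?_, by simpa using hct⟩, by simp⟩
      by_cases hi0 : i = 0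
      · exact .inl hi0
      · refine .inr (sub_ne_zero.mpr (integerPart_lt hi0 ?_).ne')
        exact lt_of_lt_of_le (by positivity) (integerPart_le hc i)
    · rintro ⟨f, ⟨hf, hft⟩, rfl⟩
      refine ⟨⟨fun i => add_nonneg (hw0 i) (Nat.cast_nonneg _), ?_, Λ.add_mem hwΛ (hΛ f), hft⟩, ?_⟩
      · refine hS.of_subset_insert_zero fun i hi hi0 => ?_
        intro hwi
        have : f i = 0 := by by_contra h; exact (hf i h).elim hi0 (fun h => h hwi)
        simp [hwi, this] at hi
      · rw [integerPart_add hw0 hwlt hw1 hf]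
        simp
  · intro c hc
    obtain ⟨hc, hcS, hcΛ, hct⟩ := (Set.Finite.mem_toFinset _).mp hc
    rw [Set.Finite.coe_toFinset]
    refine ⟨fun i => sub_nonneg.mpr (integerPart_le hc i), ?_, Λ.sub_mem hcΛ (hΛ _),
      sub_integerPart_zero_lt_one c, sub_integerPart_le_one c⟩
    refine hcS.of_subset_insert_zero fun i hi hi0 => ?_
    intro hci
    exact hi (by simp [integerPart, hi0, hci])

/-- A bounded set contains finitely many lattice points. -/
lemma finite_lattice_points {d : ℕ} {Q : Set (Fin d → ℝ)} (hQ : Bornology.IsBounded Q) :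
    {z : Fin d → ℤ | (fun i => (z i : ℝ)) ∈ Q}.Finite := by
  obtain ⟨R, hR⟩ := hQ.subset_closedBall 0
  refine (Set.finite_Icc (fun _ => -⌈R⌉) (fun _ => ⌈R⌉)).subset fun z hz => ?_
  have hz' : ∀ i, |(z i : ℝ)| ≤ ⌈R⌉ := fun i =>
    (norm_le_pi_norm (fun i => (z i : ℝ)) i).trans
      ((mem_closedBall_zero_iff.mp (hR hz)).trans (Int.le_ceil R))
  exact ⟨fun i => by exact_mod_cast (abs_le.mp (hz' i)).1,
    fun i => by exact_mod_cast (abs_le.mp (hz' i)).2⟩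

/-- Points of a dilate of a polytope are nonnegative combinations of the scaled vertices. -/
lemma mem_smul_convexHull_range_iff {d m : ℕ} {D : ℝ} (hD : 0 < D)
    (u : Fin (m + 1) → Fin d → ℝ) {t : ℝ} (ht : 0 ≤ t) (x : Fin d → ℝ) :
    x ∈ t • convexHull ℝ (Set.range fun i => D⁻¹ • u i) ↔
      ∃ c : Fin (m + 1) → ℝ, 0 ≤ c ∧ D * ∑ i, c i = t ∧ ∑ i, c i • u i = x := by
  have hull : convexHull ℝ (Set.range fun i => D⁻¹ • u i) =
      Fintype.linearCombination ℝ (fun i => D⁻¹ • u i) '' stdSimplex ℝ (Fin (m + 1)) := by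
    rw [← convexHull_rangle_single_eq_stdSimplex, LinearMap.image_convexHull, ← Set.range_comp]
    congr 2
    ext1 i
    simp [Fintype.linearCombination_apply_single]
  rw [hull]
  constructor
  · rintro ⟨-, ⟨l, ⟨hl, hl1⟩, rfl⟩, rfl⟩
    refine ⟨fun i => t * D⁻¹ * l i, fun i => mul_nonneg (by positivity) (hl i), ?_, ?_⟩
    · rw [← Finset.mul_sum, hl1]; field_simp
    · simp only [Fintype.linearCombination_apply, Finset.smul_sum, smul_smul]
      exact Finset.sum_congr rfl fun i _ => by ring_nf
  · rintro ⟨c, hc, hct, rfl⟩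
    rcases ht.eq_or_lt with rfl | ht
    · have hc0 : ∀ i, c i = 0 := by
        have : ∑ i, c i = 0 := by simpa [hD.ne'] using hct
        simpa using (Finset.sum_eq_zero_iff_of_nonneg fun i _ => hc i).mp this
      rw [Set.zero_smul_set ((Set.nonempty_of_mem (single_mem_stdSimplex ℝ 0)).image _)]
      simp [hc0]
    · refine ⟨_, ⟨fun i => D * t⁻¹ * c i, ⟨fun i => mul_nonneg (by positivity) (hc i), ?_⟩, rfl⟩, ?_⟩
      · rw [← Finset.mul_sum, mul_right_comm, hct, mul_inv_cancel₀ ht.ne']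
      · simp only [Fintype.linearCombination_apply, Finset.smul_sum, smul_smul]
        exact Finset.sum_congr rfl fun i _ => by congr 1; field_simp

/-- **Ehrhart's theorem** for the convex hull of a nonempty finite family of points of
`(1 / D) ℤ^d`. -/
lemma exists_quasiPolynomial_ehrhart_range {d m D : ℕ} [NeZero D]
    (v : Fin (m + 1) → Fin d → ℤ) :
    ∃ p : ZMod D → Polynomial ℝ, ∀ t : ℕ,
      (ehrhart (convexHull ℝ (Set.range fun i => (D : ℝ)⁻¹ • fun j => (v i j : ℝ))) t : ℝ) =
        (p t).eval (t : ℝ) := by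
  have hD : (0 : ℝ) < D := by exact_mod_cast NeZero.pos D
  set u : Fin (m + 1) → Fin d → ℝ := fun i j => (v i j : ℝ) with hu
  let φ := Fintype.linearCombination ℝ u
  let σ := Fintype.linearCombination ℝ (fun _ : Fin (m + 1) => (1 : ℝ))
  have hσ : ∀ c, σ c = ∑ i, c i := fun c => by simp [σ, Fintype.linearCombination_apply]
  let K := LinearMap.ker φ ⊓ LinearMap.ker σ
  have hK : ∀ {c c'}, c' - c ∈ K ↔ φ c' = φ c ∧ ∑ i, c' i = ∑ i, c i := by
    intro c c'
    simp [K, ← hσ, sub_eq_zero]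
  let Λ : AddSubgroup (Fin (m + 1) → ℝ) :=
    { carrier := {c | (∃ z : Fin d → ℤ, (fun j => (z j : ℝ)) = φ c) ∧ ∃ z : ℤ, D * σ c = z}
      zero_mem' := ⟨⟨0, by ext; simp⟩, 0, by simp⟩
      add_mem' := by
        rintro a b ⟨⟨y, hy⟩, y', hy'⟩ ⟨⟨z, hz⟩, z', hz'⟩
        refine ⟨⟨y + z, ?_⟩, y' + z', by rw [map_add, mul_add, hy', hz']; push_cast; rfl⟩
        rw [map_add, ← hy, ← hz]; ext; simp
      neg_mem' := by
        rintro a ⟨⟨y, hy⟩, y', hy'⟩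
        refine ⟨⟨-y, ?_⟩, -y', by rw [map_neg, mul_neg, hy']; push_cast; rfl⟩
        rw [map_neg, ← hy]; ext; simp }
  set P := convexHull ℝ (Set.range fun i => (D : ℝ)⁻¹ • u i) with hP
  have himage : ∀ t : ℕ, φ '' cellPoints K Λ D t =
      (fun (z : Fin d → ℤ) j => (z j : ℝ)) '' {z | (fun j => (z j : ℝ)) ∈ (t : ℝ) • P} := by
    intro t
    ext x
    constructor
    · rintro ⟨c, ⟨hc, hcS, ⟨⟨z, hz⟩, -⟩, hct⟩, rfl⟩
      refine ⟨z, ?_, hz⟩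
      exact (mem_smul_convexHull_range_iff hD u t.cast_nonneg _).mpr ⟨c, hc, hct, hz.symm⟩
    · rintro ⟨z, hz, rfl⟩
      obtain ⟨b, hb, hbt, hbz⟩ := (mem_smul_convexHull_range_iff hD u t.cast_nonneg _).mp hz
      have hcomp : IsCompact {c | 0 ≤ c ∧ c - b ∈ K} := by
        refine (isCompact_Icc (a := 0) (b := fun _ => ∑ i, b i)).of_isClosed_subset ?_ ?_
        · exact isClosed_Ici.inter (K.closed_of_finiteDimensional.preimage (by fun_prop))
        · rintro c ⟨hc, hcb⟩
          refine ⟨hc, fun i => ?_⟩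
          rw [← (hK.mp hcb).2]
          exact Finset.single_le_sum (fun i _ => hc i) (Finset.mem_univ i)
      obtain ⟨c, hc, hcb, hcS⟩ := exists_isLexCell_support hb hcomp
      obtain ⟨hφ, hs⟩ := hK.mp hcb
      have hcz : φ c = fun j => (z j : ℝ) := hφ.trans hbz
      have hct : (D : ℝ) * ∑ i, c i = t := by rw [hs, hbt]
      exact ⟨c, ⟨hc, hcS, ⟨⟨z, hcz.symm⟩, t, by rw [hσ, hct]; simp⟩, hct⟩, hcz⟩
  have hinj : ∀ t, Set.InjOn φ (cellPoints K Λ D t) := by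
    rintro t c ⟨hc, hcS, -, hct⟩ c' ⟨hc', hcS', -, hct'⟩ h
    refine hcS'.eq_of_sub_mem hc' hc hcS (hK.mpr ⟨h, ?_⟩)
    exact mul_left_cancel₀ hD.ne' (hct.trans hct'.symm)
  have hbdd : Bornology.IsBounded P :=
    ((Set.finite_range _).isCompact_convexHull ℝ).isBounded
  have hfin : ∀ t, (cellPoints K Λ D t).Finite := fun t =>
    Set.Finite.of_finite_image
      (himage t ▸ (finite_lattice_points (hbdd.smul₀ (t : ℝ))).image _) (hinj t)
  obtain ⟨p, hp⟩ := exists_quasiPolynomial_ncard_cellPoints (K := K) (Λ := Λ) (D := D)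
    (fun f => ⟨⟨fun j => ∑ i, f i * v i j, by
        ext j; simp [φ, u, Fintype.linearCombination_apply, Finset.sum_apply]⟩,
      D * ∑ i, f i, by simp [hσ]⟩)
    (fun c hc => by obtain ⟨z, hz⟩ := hc.2; exact ⟨z, by rw [← hz, hσ]⟩) hfin
  refine ⟨p, fun t => ?_⟩
  rw [← hp t, ← (hinj t).ncard_image, himage t, Set.ncard_image_of_injective]
  · rfl
  · intro y z hyz
    ext j
    exact Int.cast_injective (α := ℝ) (congrFun hyz j)

/-- **Ehrhart's theorem**, with the quasi-polynomial given by one polynomial for each residue class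
modulo a common denominator `D` of the coordinates of the vertices. -/
lemma exists_quasiPolynomial_ehrhart {d : ℕ} {V : Set (Fin d → ℝ)} (hV : V.Finite) {D : ℕ}
    [NeZero D] (h : ∀ x ∈ Set.extremePoints ℝ (convexHull ℝ V), ∀ i : Fin d,
      ∃ z : ℤ, x i = (z : ℝ) / (D : ℝ)) :
    ∃ p : ZMod D → Polynomial ℝ, ∀ t : ℕ,
      (ehrhart (convexHull ℝ V) t : ℝ) = (p t).eval (t : ℝ) := by
  have hD : (D : ℝ) ≠ 0 := by exact_mod_cast NeZero.ne D
  set E := Set.extremePoints ℝ (convexHull ℝ V) with hE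
  have hEfin : E.Finite := hV.subset extremePoints_convexHull_subset
  have hhull : convexHull ℝ E = convexHull ℝ V := by
    rw [← closure_convexHull_extremePoints (hV.isCompact_convexHull ℝ) (convex_convexHull ℝ V),
      (hEfin.isClosed_convexHull ℝ).closure_eq]
  rw [← hhull]
  rcases E.eq_empty_or_nonempty with hempty | hne
  · exact ⟨0, fun t => by simp [ehrhart, hempty]⟩
  obtain ⟨n, f, -, hf⟩ := hEfin.fin_param
  cases n with
  | zero => simp [← hf] at hne
  | succ m =>
    choose v hv using fun i => h (f i) (hf ▸ Set.mem_range_self i)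
    have hfv : f = fun i => (D : ℝ)⁻¹ • fun j => (v i j : ℝ) := by
      ext i j
      simp [hv, div_eq_inv_mul]
    rw [← hf, hfv]
    exact exists_quasiPolynomial_ehrhart_range v

theorem stmt1 (d : ℕ) (V : Set (Fin d → ℝ)) (hV : V.Finite)
    (P : Set (Fin d → ℝ)) (hP : P = convexHull ℝ V)
    (hrat : ∀ x ∈ Set.extremePoints ℝ P, ∀ i : Fin d, ∃ q : ℚ, x i = (q : ℝ)) :
    -- `i(P,t)` is a quasi-polynomial whose period divides the denominator of `P`:
    -- every positive common denominator `D` of the coordinates of the vertices is a period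
    (∀ D : ℕ, 0 < D →
      (∀ x ∈ Set.extremePoints ℝ P, ∀ i : Fin d, ∃ z : ℤ, x i = (z : ℝ) / (D : ℝ)) →
      ∃ (n : ℕ) (a : ℕ → ℕ → ℝ),
        (∀ j ≤ n, ∀ t : ℕ, a j (t + D) = a j t) ∧
        ∀ t : ℕ, (ehrhart P t : ℝ) = ∑ j ∈ Finset.range (n + 1), a j t * (t : ℝ) ^ j) ∧
    -- in particular, if `P` is an integral polytope then `i(P,t)` is a polynomial in `t`
    ((∀ x ∈ Set.extremePoints ℝ P, ∀ i : Fin d, ∃ z : ℤ, x i = (z : ℝ)) →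
      ∃ p : Polynomial ℝ, ∀ t : ℕ, (ehrhart P t : ℝ) = p.eval (t : ℝ)) := by
  subst hP
  constructor
  · intro D hD h
    have : NeZero D := ⟨hD.ne'⟩
    obtain ⟨p, hp⟩ := exists_quasiPolynomial_ehrhart hV h
    refine ⟨Finset.univ.sup fun r => (p r).natDegree, fun j t => (p t).coeff j,
      fun j _ t => by simp, fun t => ?_⟩
    rw [hp t]
    exact Polynomial.eval_eq_sum_range' (Nat.lt_succ_of_le
      (Finset.le_sup (f := fun r => (p r).natDegree) (Finset.mem_univ _))) _
  · intro h
    obtain ⟨p, hp⟩ := exists_quasiPolynomial_ehrhart (D := 1) hV (by simpa using h)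
    exact ⟨p 0, fun t => by rw [hp t, Subsingleton.elim (t : ZMod 1) 0]⟩
end

section
/- Let C be a chamber (a maximal cell) of the chamber complex of cone(Δ+) for the root system of type A_{k−1}. Then the restriction of the Kostant partition function K to the lattice points of C agrees with a polynomial function in v = (v_1,…,v_k) of degree at most (k−1 choose 2). -/
/-- The set of positive roots `Δ+ = {e_i - e_j : i < j}` of type `A_{k-1}`. -/
def posRoots (k : ℕ) : Set (Fin k → ℝ) :=
  {v | ∃ i j : Fin k, i < j ∧ v = Pi.single i (1 : ℝ) - Pi.single j (1 : ℝ)}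

/-- The cone of nonnegative real combinations of elements of `S`. -/
def coneOf {k : ℕ} (S : Set (Fin k → ℝ)) : Set (Fin k → ℝ) :=
  {x | ∃ (n : ℕ) (c : Fin n → ℝ) (u : Fin n → (Fin k → ℝ)),
    (∀ m, 0 ≤ c m) ∧ (∀ m, u m ∈ S) ∧ x = ∑ m, c m • u m}

/-- `B` is a maximal linearly independent subset of `Δ+`. -/
def IsMaxIndep (k : ℕ) (B : Set (Fin k → ℝ)) : Prop :=
  B ⊆ posRoots k ∧ LinearIndependent ℝ ((↑) : B → (Fin k → ℝ)) ∧
    ∀ B' : Set (Fin k → ℝ), B ⊆ B' → B' ⊆ posRoots k →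
      LinearIndependent ℝ ((↑) : B' → (Fin k → ℝ)) → B' = B

/-- `C` is a chamber (a maximal cell) of the chamber complex of `cone(Δ+)`: `C` is the
intersection of all the cones `cone(B)`, over maximal linearly independent `B ⊆ Δ+`,
containing some fixed point `x` of `cone(Δ+)`, and `C` is full-dimensional (its linear span
is all of the linear span of `Δ+`). -/
def IsChamber (k : ℕ) (C : Set (Fin k → ℝ)) : Prop :=
  (∃ x ∈ coneOf (posRoots k),
      C = ⋂₀ {D | ∃ B : Set (Fin k → ℝ), IsMaxIndep k B ∧ x ∈ coneOf B ∧ D = coneOf B}) ∧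
  Submodule.span ℝ C = Submodule.span ℝ (posRoots k)


/-!
STATEMENT 2: Let C be a chamber (a maximal cell) of the chamber complex of cone(Δ+) for
the root system of type A_{k−1}.  Then the restriction of the Kostant partition function K
to the lattice points of C agrees with a polynomial function in v = (v_1,…,v_k) of degree
at most (k−1 choose 2).
-/

/-- The Kostant partition function for the root system of type `A_{k-1}`: `kostant k v` is
the number of ways to write `v` as a nonnegative integer combination of the positive roots
`e_i - e_j`, `i < j`.  A combination is recorded as a matrix `b` of nonnegative integers
supported on pairs `(i, j)` with `i < j`; the coordinate `i` of
`Σ_{i<j} b_{ij} (e_i - e_j)` is `Σ_j b_{ij} - Σ_j b_{ji}`. -/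
noncomputable def kostant (k : ℕ) (v : Fin k → ℤ) : ℕ :=
  Nat.card {b : Fin k × Fin k → ℕ //
    (∀ p : Fin k × Fin k, ¬ p.1 < p.2 → b p = 0) ∧
    ∀ i : Fin k, (∑ j : Fin k, (b (i, j) : ℤ)) - (∑ j : Fin k, (b (j, i) : ℤ)) = v i}

/-- The root `e_i - e_j` attached to a pair `p = (i, j)`. -/
def rootVec {k : ℕ} (p : Fin k × Fin k) : Fin k → ℝ :=
  Pi.single p.1 (1 : ℝ) - Pi.single p.2 (1 : ℝ)

/-- The linear functional on `ℝ^k` with integer coefficient vector `w`. -/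
def pairing {k : ℕ} (w : Fin k → ℤ) (u : Fin k → ℝ) : ℝ := ∑ j, (w j : ℝ) * u j

section Pairing

variable {k : ℕ}

lemma pairing_add (w : Fin k → ℤ) (u u' : Fin k → ℝ) :
    pairing w (u + u') = pairing w u + pairing w u' := by
  simp [pairing, mul_add, Finset.sum_add_distrib]

lemma pairing_smul (w : Fin k → ℤ) (c : ℝ) (u : Fin k → ℝ) :
    pairing w (c • u) = c * pairing w u := by
  simp only [pairing, Pi.smul_apply, smul_eq_mul, Finset.mul_sum]
  exact Finset.sum_congr rfl fun _ _ => by ring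

lemma pairing_sum {ι : Type*} (s : Finset ι) (w : Fin k → ℤ) (u : ι → Fin k → ℝ) :
    pairing w (∑ i ∈ s, u i) = ∑ i ∈ s, pairing w (u i) := by
  simp only [pairing, Finset.sum_apply, Finset.mul_sum]
  exact Finset.sum_comm

lemma pairing_rootVec (w : Fin k → ℤ) (p : Fin k × Fin k) :
    pairing w (rootVec p) = ((w p.1 - w p.2 : ℤ) : ℝ) := by
  simp [pairing, rootVec, mul_sub, Finset.sum_sub_distrib, Pi.single_apply]

lemma pairing_intCast (w v : Fin k → ℤ) :
    pairing w (fun j => (v j : ℝ)) = ((∑ j, w j * v j : ℤ) : ℝ) := by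
  simp [pairing]

lemma sum_rootVec (p : Fin k × Fin k) : ∑ j, rootVec p j = 0 := by
  simp [rootVec, Finset.sum_sub_distrib]

end Pairing

/-- A family `b` of positive roots forming a basis of the span of all roots, together with
integer coefficient vectors `w` of its coordinate functionals. -/
structure IsChart {k n : ℕ} (b : Fin n → Fin k × Fin k) (w : Fin n → Fin k → ℤ) : Prop where
  lt : ∀ i, (b i).1 < (b i).2
  dual : ∀ i j, w i (b j).1 - w i (b j).2 = if i = j then 1 else 0
  span : ∀ u : Fin k → ℝ, ∑ j, u j = 0 → u = ∑ i, pairing (w i) u • rootVec (b i)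

namespace IsChart

variable {k n : ℕ} {b : Fin n → Fin k × Fin k} {w : Fin n → Fin k → ℤ}

lemma pairing_root (h : IsChart b w) (i j : Fin n) :
    pairing (w i) (rootVec (b j)) = if i = j then 1 else 0 := by
  rw [pairing_rootVec, h.dual]
  split_ifs <;> simp

/-- The coefficient vector of a coordinate functional takes two consecutive values. -/
lemma two_valued (h : IsChart b w) (i : Fin n) (a : Fin k) :
    w i a = w i (b i).2 ∨ w i a = w i (b i).2 + 1 := by
  by_contra! hne
  have hi : w i (b i).1 = w i (b i).2 + 1 := by
    have := h.dual i i
    rw [if_pos rfl] at this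
    linarith
  set level : Fin k → ℤ := fun j => if w i j = w i a then 1 else 0 with hlevel
  have hroot : ∀ j, pairing level (rootVec (b j)) = 0 := by
    intro j
    rw [pairing_rootVec]
    by_cases hij : i = j
    · subst hij
      simp only [hlevel]
      rw [if_neg (by rw [hi]; exact Ne.symm hne.2), if_neg (Ne.symm hne.1)]
      simp
    · have := h.dual i j
      rw [if_neg hij, sub_eq_zero] at this
      simp [hlevel, this]
  have hzero : pairing level (rootVec (a, (b i).1)) = 0 := by
    rw [h.span _ (sum_rootVec (a, (b i).1)), pairing_sum]
    exact Finset.sum_eq_zero fun j _ => by rw [pairing_smul, hroot, mul_zero]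
  rw [pairing_rootVec] at hzero
  simp only [hlevel, if_true] at hzero
  rw [if_neg (by rw [hi]; exact Ne.symm hne.2)] at hzero
  norm_num at hzero

lemma exists_sum_eq (h : IsChart b w) (i : Fin n) :
    ∃ I : Finset (Fin k), I.Nonempty ∧ I ≠ Finset.univ ∧
      ∀ u : Fin k → ℝ, ∑ j, u j = 0 → pairing (w i) u = ∑ j ∈ I, u j := by
  have hi : w i (b i).1 = w i (b i).2 + 1 := by
    have := h.dual i i
    rw [if_pos rfl] at this
    linarith
  refine ⟨Finset.univ.filter fun j => w i j = w i (b i).2 + 1, ⟨(b i).1, by simp [hi]⟩, ?_, ?_⟩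
  · intro hI
    have : (b i).2 ∈ Finset.univ.filter fun j => w i j = w i (b i).2 + 1 := by
      rw [hI]; exact Finset.mem_univ _
    simp at this
  · intro u hu
    have : pairing (w i) u = ∑ j, ((w i j : ℝ) - w i (b i).2) * u j := by
      simp only [pairing, sub_mul, Finset.sum_sub_distrib, ← Finset.mul_sum, hu, mul_zero, sub_zero]
    rw [this, Finset.sum_filter]
    refine Finset.sum_congr rfl fun j _ => ?_
    rcases h.two_valued i j with hj | hj <;> simp [hj]

lemma coeff_cases (h : IsChart b w) (i : Fin n) (g : Fin k × Fin k) :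
    w i g.1 - w i g.2 = -1 ∨ w i g.1 - w i g.2 = 0 ∨ w i g.1 - w i g.2 = 1 := by
  rcases h.two_valued i g.1 with h1 | h1 <;> rcases h.two_valued i g.2 with h2 | h2 <;> omega

end IsChart

/-- The coordinate functionals after the `m`-th basis root has been replaced by `g`. -/
def exchangeCoeff {k n : ℕ} (w : Fin n → Fin k → ℤ) (g : Fin k × Fin k) (m : Fin n) :
    Fin n → Fin k → ℤ := fun i =>
  if i = m then (w m g.1 - w m g.2) • w m
  else w i - ((w i g.1 - w i g.2) * (w m g.1 - w m g.2)) • w m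

lemma pairing_exchangeCoeff {k n : ℕ} (w : Fin n → Fin k → ℤ) (g : Fin k × Fin k) (m i : Fin n)
    (u : Fin k → ℝ) :
    pairing (exchangeCoeff w g m i) u =
      if i = m then ((w m g.1 - w m g.2 : ℤ) : ℝ) * pairing (w m) u
      else pairing (w i) u -
        ((w i g.1 - w i g.2 : ℤ) : ℝ) * ((w m g.1 - w m g.2 : ℤ) : ℝ) * pairing (w m) u := by
  unfold exchangeCoeff
  split_ifs
  · simp only [pairing, Finset.mul_sum, Pi.smul_apply, smul_eq_mul, Int.cast_mul, mul_assoc]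
  · simp only [pairing, Finset.mul_sum, Pi.smul_apply, Pi.sub_apply, smul_eq_mul, Int.cast_mul,
      Int.cast_sub, sub_mul, Finset.sum_sub_distrib, mul_assoc]

lemma IsChart.exchange {k n : ℕ} {b : Fin n → Fin k × Fin k} {w : Fin n → Fin k → ℤ}
    (h : IsChart b w) {g : Fin k × Fin k} (hg : g.1 < g.2) {m : Fin n}
    (hm : w m g.1 - w m g.2 ≠ 0) :
    IsChart (Function.update b m g) (exchangeCoeff w g m) := by
  have hsq : ((w m g.1 - w m g.2 : ℤ) : ℝ) * ((w m g.1 - w m g.2 : ℤ) : ℝ) = 1 := by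
    rcases h.coeff_cases m g with h1 | h1 | h1
    · rw [h1]; norm_num
    · exact absurd h1 hm
    · rw [h1]; norm_num
  refine ⟨fun i => ?_, fun i j => ?_, fun u hu => ?_⟩
  · by_cases hi : i = m
    · subst hi; simpa using hg
    · simpa [Function.update_of_ne hi] using h.lt i
  · have key : pairing (exchangeCoeff w g m i) (rootVec (Function.update b m g j)) =
        if i = j then 1 else 0 := by
      rw [pairing_exchangeCoeff]
      by_cases hj : j = m
      · subst hj
        rw [Function.update_self]
        split_ifs with hi
        · rw [pairing_rootVec, hsq]
        · rw [pairing_rootVec, pairing_rootVec, mul_assoc, hsq, mul_one, sub_self]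
      · rw [Function.update_of_ne hj, h.pairing_root, h.pairing_root, if_neg (Ne.symm hj)]
        by_cases hi : i = m
        · subst hi; simp [Ne.symm hj]
        · simp [hi]
    rw [pairing_rootVec] at key
    split_ifs at key ⊢ <;> exact_mod_cast key
  · have hspan := h.span u hu
    have hgspan := h.span (rootVec g) (sum_rootVec g)
    simp only [pairing_rootVec] at hgspan
    rw [← Finset.add_sum_erase _ _ (Finset.mem_univ m)] at hspan hgspan ⊢
    have hrest : ∀ i ∈ Finset.univ.erase m,
        pairing (exchangeCoeff w g m i) u • rootVec (Function.update b m g i) =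
        pairing (w i) u • rootVec (b i) - (((w m g.1 - w m g.2 : ℤ) : ℝ) * pairing (w m) u) •
          (((w i g.1 - w i g.2 : ℤ) : ℝ) • rootVec (b i)) := by
      intro i hi
      have hi' := Finset.ne_of_mem_erase hi
      rw [pairing_exchangeCoeff, if_neg hi', Function.update_of_ne hi', smul_smul, ← sub_smul]
      congr 1
      ring
    rw [Finset.sum_congr rfl hrest, Finset.sum_sub_distrib, ← Finset.smul_sum,
      pairing_exchangeCoeff, if_pos rfl, Function.update_self, eq_sub_of_add_eq' hspan.symm,
      eq_sub_of_add_eq' hgspan.symm, smul_sub, smul_smul]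
    have : ((w m g.1 - w m g.2 : ℤ) : ℝ) * pairing (w m) u * ((w m g.1 - w m g.2 : ℤ) : ℝ) =
        pairing (w m) u := by
      rw [mul_right_comm, hsq, one_mul]
    rw [this]
    abel

open Classical in
/-- Signed decomposition of the indicator of a simplicial cone with respect to a vector whose
coordinates in that cone are `c`: the inner indicators are those of the cones obtained by
exchanging one generator for the vector. -/
lemma indicator_eq_sum_exchange {n : ℕ} (u : Fin n → ℝ) (c : Fin n → ℤ)
    (hc : ∀ i, c i = -1 ∨ c i = 0 ∨ c i = 1) (hex : ∃ i, c i = 1) (hu : ∀ i, u i ≠ 0)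
    (hne : ∀ i j, i ≠ j → c i ≠ 0 → c j ≠ 0 → (c i : ℝ) * u i ≠ c j * u j)
    (D : Fin n → Prop)
    (hD : ∀ j, c j ≠ 0 →
      (D j ↔ ∀ i, 0 < if i = j then (c j : ℝ) * u j else u i - c i * c j * u j)) :
    (if ∀ j, 0 < u j then (1 : ℚ) else 0) = ∑ j, (c j : ℚ) * if D j then 1 else 0 := by
  by_cases hZ : ∃ i, c i = 0 ∧ u i < 0
  · obtain ⟨i₀, hi₀, hneg⟩ := hZ
    rw [if_neg (fun h => absurd (h i₀) (not_lt.mpr hneg.le)), eq_comm]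
    refine Finset.sum_eq_zero fun j _ => ?_
    by_cases hj : c j = 0
    · simp [hj]
    · rw [if_neg, mul_zero]
      intro hDj
      have h1 := (hD j hj).mp hDj i₀
      rw [if_neg (by rintro rfl; exact hj hi₀), hi₀] at h1
      simp at h1
      linarith
  have hZ' : ∀ i, c i = 0 → 0 < u i := by
    intro i hi
    by_contra hlt
    exact hZ ⟨i, hi, lt_of_le_of_ne (not_lt.mp hlt) (hu i)⟩
  have hpos : ∀ j, c j = 1 →
      (D j ↔ 0 < u j ∧ (∀ i, i ≠ j → c i = 1 → u j < u i) ∧ ∀ i, c i = -1 → -u i < u j) := by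
    intro j hj
    rw [hD j (by omega), hj]
    constructor
    · intro h
      refine ⟨by simpa using h j, fun i hij hi => ?_, fun i hi => ?_⟩
      · have := h i
        rw [if_neg hij, hi] at this
        simp at this
        linarith
      · have := h i
        rw [if_neg (by rintro rfl; omega), hi] at this
        simp at this
        linarith
    · rintro ⟨h1, h2, h3⟩ i
      split_ifs with hij
      · simpa using h1
      · rcases hc i with hi | hi | hi
        · have := h3 i hi
          rw [hi]; push_cast; linarith
        · have := hZ' i hi
          rw [hi]; push_cast; linarith
        · have := h2 i hij hi
          rw [hi]; push_cast; linarith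
  have hneg : ∀ j, c j = -1 →
      (D j ↔ u j < 0 ∧ (∀ i, c i = 1 → -u j < u i) ∧ ∀ i, i ≠ j → c i = -1 → u j < u i) := by
    intro j hj
    rw [hD j (by omega), hj]
    constructor
    · intro h
      refine ⟨by simpa using h j, fun i hi => ?_, fun i hij hi => ?_⟩
      · have := h i
        rw [if_neg (by rintro rfl; omega), hi] at this
        simp at this
        linarith
      · have := h i
        rw [if_neg hij, hi] at this
        simp at this
        linarith
    · rintro ⟨h1, h2, h3⟩ i
      split_ifs with hij
      · simpa using h1
      · rcases hc i with hi | hi | hi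
        · have := h3 i hij hi
          rw [hi]; push_cast; linarith
        · have := hZ' i hi
          rw [hi]; push_cast; linarith
        · have := h2 i hi
          rw [hi]; push_cast; linarith
  obtain ⟨jP, hjP, hmin⟩ := Finset.exists_min_image (Finset.univ.filter fun i => c i = 1) u
    (by obtain ⟨i, hi⟩ := hex; exact ⟨i, by simp [hi]⟩)
  simp only [Finset.mem_filter, Finset.mem_univ, true_and] at hjP hmin
  have hmin' : ∀ i, i ≠ jP → c i = 1 → u jP < u i := by
    intro i hij hi
    refine lt_of_le_of_ne (hmin i hi) ?_
    have := hne i jP hij (by omega) (by omega)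
    rw [hi, hjP] at this
    simpa using this.symm
  have hPfalse : ∀ j, j ≠ jP → c j = 1 → ¬ D j := by
    intro j hj hcj hDj
    have := ((hpos j hcj).mp hDj).2.1 jP hj.symm hjP
    linarith [hmin' j hj hcj]
  by_cases hN : ∃ i, c i = -1 ∧ u i < 0
  · obtain ⟨jN, hjN, hmax⟩ := Finset.exists_min_image (Finset.univ.filter fun i => c i = -1) u
      (by obtain ⟨i, hi, _⟩ := hN; exact ⟨i, by simp [hi]⟩)
    simp only [Finset.mem_filter, Finset.mem_univ, true_and] at hjN hmax
    have hmax' : ∀ i, i ≠ jN → c i = -1 → u jN < u i := by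
      intro i hij hi
      refine lt_of_le_of_ne (hmax i hi) ?_
      have := hne i jN hij (by omega) (by omega)
      rw [hi, hjN] at this
      simpa using this.symm
    have hNneg : u jN < 0 := by
      obtain ⟨i, hi, hlt⟩ := hN
      exact (hmax i hi).trans_lt hlt
    rw [if_neg (fun h => absurd (h jN) (not_lt.mpr hNneg.le)),
      Fintype.sum_eq_add jP jN (by rintro rfl; omega)]
    · have hiff : D jP ↔ D jN := by
        rw [hpos jP hjP, hneg jN hjN]
        constructor
        · rintro ⟨-, -, h3⟩
          exact ⟨hNneg, fun i hi => (h3 jN hjN).trans_le (hmin i hi), hmax'⟩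
        · rintro ⟨-, h2, -⟩
          have := h2 jP hjP
          exact ⟨by linarith, hmin', fun i hi => by linarith [hmax i hi]⟩
      simp only [hjP, hjN, hiff]
      push_cast
      ring
    · rintro j ⟨hj1, hj2⟩
      rcases hc j with hj | hj | hj
      · rw [if_neg, mul_zero]
        intro hDj
        have := ((hneg j hj).mp hDj).2.2 jN hj2.symm hjN
        linarith [hmax' j hj2 hj]
      · simp [hj]
      · rw [if_neg (hPfalse j hj1 hj), mul_zero]
  · have hN' : ∀ i, c i = -1 → 0 < u i := by
      intro i hi
      by_contra hlt
      exact hN ⟨i, hi, lt_of_le_of_ne (not_lt.mp hlt) (hu i)⟩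
    rw [Fintype.sum_eq_single jP]
    · have hiff : D jP ↔ ∀ j, 0 < u j := by
        rw [hpos jP hjP]
        constructor
        · rintro ⟨h1, -, -⟩ i
          rcases hc i with hi | hi | hi
          · exact hN' i hi
          · exact hZ' i hi
          · exact h1.trans_le (hmin i hi)
        · intro h
          exact ⟨h jP, hmin', fun i hi => by linarith [h jP, h i]⟩
      simp [hiff, hjP]
    · intro j hj1
      rcases hc j with hj | hj | hj
      · rw [if_neg, mul_zero]
        intro hDj
        linarith [((hneg j hj).mp hDj).1, hN' j hj]
      · simp [hj]
      · rw [if_neg (hPfalse j hj1 hj), mul_zero]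

section Antidifference

open MvPolynomial

lemma exists_faulhaber (j : ℕ) :
    ∃ F : Polynomial ℚ, F.natDegree ≤ j + 1 ∧ F.eval 0 = 0 ∧
      ∀ x : ℚ, F.eval x - F.eval (x - 1) = x ^ j := by
  have hj : (j + 1 : ℚ) ≠ 0 := by positivity
  have hdeg : (Polynomial.bernoulli (j + 1)).natDegree ≤ j + 1 := by
    rw [Polynomial.bernoulli]
    refine Polynomial.natDegree_sum_le_of_forall_le _ _ fun i hi => ?_
    exact (Polynomial.natDegree_monomial_le _).trans (by omega)
  refine ⟨Polynomial.C ((j + 1 : ℚ)⁻¹) * ((Polynomial.bernoulli (j + 1)).comp (1 + Polynomial.X) -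
    Polynomial.C ((Polynomial.bernoulli (j + 1)).eval 1)), ?_, by simp, fun x => ?_⟩
  · refine (Polynomial.natDegree_C_mul_le _ _).trans ?_
    refine (Polynomial.natDegree_sub_le _ _).trans (max_le ?_ (by simp))
    refine Polynomial.natDegree_comp_le.trans ?_
    have : (1 + Polynomial.X : Polynomial ℚ).natDegree ≤ 1 := by
      rw [add_comm]; exact (Polynomial.natDegree_X_add_C (1 : ℚ)).le
    calc _ ≤ (j + 1) * 1 := Nat.mul_le_mul hdeg this
      _ = j + 1 := mul_one _
  · have h := Polynomial.bernoulli_eval_one_add (j + 1) x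
    simp only [Polynomial.eval_mul, Polynomial.eval_C, Polynomial.eval_sub, Polynomial.eval_comp,
      Polynomial.eval_add, Polynomial.eval_one, Polynomial.eval_X, add_sub_cancel]
    rw [h]
    push_cast
    field_simp
    simp

lemma totalDegree_polynomial_aeval_le {σ : Type*} (T : MvPolynomial σ ℚ) (hT : T.totalDegree ≤ 1)
    (F : Polynomial ℚ) : (Polynomial.aeval T F).totalDegree ≤ F.natDegree := by
  rw [Polynomial.aeval_eq_sum_range]
  refine totalDegree_finsetSum_le fun i hi => ?_
  refine (totalDegree_smul_le _ _).trans ((totalDegree_pow _ _).trans ?_)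
  have : i ≤ F.natDegree := by simpa [Nat.lt_succ_iff] using hi
  nlinarith

variable {σ : Type*}

/-- Span of products of a polynomial invariant under translation by `g` and a power of `T`. -/
noncomputable def invariantPowerSpan (g : σ → ℚ) (T : MvPolynomial σ ℚ) (d : ℕ) :
    Submodule ℚ (MvPolynomial σ ℚ) :=
  Submodule.span ℚ {p | ∃ (j : ℕ) (R : MvPolynomial σ ℚ), R.totalDegree + j ≤ d ∧
    (∀ v : σ → ℚ, eval (v - g) R = eval v R) ∧ p = R * T ^ j}

lemma X_mul_mem_invariantPowerSpan {g : σ → ℚ} {T : MvPolynomial σ ℚ} (hT : T.totalDegree ≤ 1)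
    (hshift : ∀ v, eval (v - g) T = eval v T - 1) (i : σ) {d : ℕ} {p : MvPolynomial σ ℚ}
    (hp : p ∈ invariantPowerSpan g T d) : X i * p ∈ invariantPowerSpan g T (d + 1) := by
  induction hp using Submodule.span_induction with
  | mem p hp =>
    obtain ⟨j, R, hdeg, hinv, rfl⟩ := hp
    have hsplit : X i * (R * T ^ j) =
        (R * (X i - g i • T)) * T ^ j + g i • (R * T ^ (j + 1)) := by
      simp only [smul_eq_C_mul]; ring
    rw [hsplit]
    refine Submodule.add_mem _ (Submodule.subset_span ⟨j, _, ?_, fun v => ?_, rfl⟩)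
      (Submodule.smul_mem _ _ (Submodule.subset_span ⟨j + 1, R, by omega, hinv, rfl⟩))
    · have h1 : (X i - g i • T : MvPolynomial σ ℚ).totalDegree ≤ 1 :=
        (totalDegree_sub _ _).trans
          (max_le (totalDegree_X _).le ((totalDegree_smul_le _ _).trans hT))
      have := totalDegree_mul R (X i - g i • T)
      omega
    · simp only [map_mul, map_sub, smul_eval, eval_X, hinv, hshift, Pi.sub_apply]
      ring
  | zero => simp
  | add p q _ _ hp hq => rw [mul_add]; exact Submodule.add_mem _ hp hq
  | smul c p _ hp => rw [mul_smul_comm]; exact Submodule.smul_mem _ _ hp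

lemma invariantPowerSpan_mono (g : σ → ℚ) (T : MvPolynomial σ ℚ) {d d' : ℕ} (h : d ≤ d') :
    invariantPowerSpan g T d ≤ invariantPowerSpan g T d' :=
  Submodule.span_mono fun _ ⟨j, R, h1, h2, h3⟩ => ⟨j, R, h1.trans h, h2, h3⟩

lemma mem_invariantPowerSpan {g : σ → ℚ} {T : MvPolynomial σ ℚ} (hT : T.totalDegree ≤ 1)
    (hshift : ∀ v, eval (v - g) T = eval v T - 1) {d : ℕ} {p : MvPolynomial σ ℚ}
    (hp : p.totalDegree ≤ d) : p ∈ invariantPowerSpan g T d := by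
  have hmon : ∀ (d : ℕ) (s : σ →₀ ℕ), s.degree = d →
      (monomial s (1 : ℚ)) ∈ invariantPowerSpan g T d := by
    intro d
    induction d with
    | zero =>
      intro s hs
      rw [(Finsupp.degree_eq_zero_iff s).mp hs]
      exact Submodule.subset_span ⟨0, 1, by simp, by simp, by simp⟩
    | succ d ih =>
      intro s hs
      obtain ⟨i, hi⟩ : ∃ i, s i ≠ 0 := by
        by_contra! h
        have : s = 0 := Finsupp.ext h
        simp [this] at hs
      have hle : Finsupp.single i 1 ≤ s := by
        rw [Finsupp.single_le_iff]; omega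
      obtain ⟨t, rfl⟩ := exists_add_of_le hle
      rw [map_add, Finsupp.degree_single] at hs
      have := X_mul_mem_invariantPowerSpan hT hshift i (ih t (by omega))
      rwa [X, monomial_mul, one_mul] at this
  rw [p.as_sum]
  refine Submodule.sum_mem _ fun s hs => ?_
  have : monomial s (coeff s p) = coeff s p • monomial s (1 : ℚ) := by
    rw [smul_monomial, smul_eq_mul, mul_one]
  rw [this]
  refine Submodule.smul_mem _ _ (invariantPowerSpan_mono g T ?_ (hmon _ s rfl))
  exact (le_totalDegree hs).trans hp

/-- Discrete antidifferentiation of polynomials in the direction `g`, with the antiderivative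
vanishing on the hyperplane `T = 0`. -/
lemma exists_antidifference {g : σ → ℚ} {T : MvPolynomial σ ℚ} (hT : T.totalDegree ≤ 1)
    (hshift : ∀ v, eval (v - g) T = eval v T - 1) {d : ℕ} {p : MvPolynomial σ ℚ}
    (hp : p.totalDegree ≤ d) :
    ∃ q : MvPolynomial σ ℚ, q.totalDegree ≤ d + 1 ∧
      (∀ v, eval v q - eval (v - g) q = eval v p) ∧ ∀ v, eval v T = 0 → eval v q = 0 := by
  have hmem := mem_invariantPowerSpan hT hshift hp
  clear hp
  induction hmem using Submodule.span_induction with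
  | mem p hp =>
    obtain ⟨j, R, hdeg, hinv, rfl⟩ := hp
    obtain ⟨F, hF, hF0, hFd⟩ := exists_faulhaber j
    have heval : ∀ v, eval v (Polynomial.aeval T F) = F.eval (eval v T) := by
      intro v
      rw [← MvPolynomial.coe_aeval_eq_eval, RingHom.coe_coe, ← Polynomial.aeval_algHom_apply,
        Polynomial.coe_aeval_eq_eval]
    refine ⟨R * Polynomial.aeval T F, ?_, fun v => ?_, fun v hv => ?_⟩
    · have h1 := totalDegree_mul R (Polynomial.aeval T F)
      have h2 := totalDegree_polynomial_aeval_le T hT F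
      omega
    · simp only [map_mul, map_pow, heval, hinv, hshift, ← mul_sub, hFd]
    · simp only [map_mul, heval, hv, hF0, mul_zero]
  | zero => exact ⟨0, by simp, by simp, by simp⟩
  | add p p' _ _ hp hp' =>
    obtain ⟨q, h1, h2, h3⟩ := hp
    obtain ⟨q', h1', h2', h3'⟩ := hp'
    refine ⟨q + q', (totalDegree_add _ _).trans (max_le h1 h1'), fun v => ?_, fun v hv => ?_⟩
    · simp only [map_add, ← h2, ← h2']; ring
    · simp [h3 v hv, h3' v hv]
  | smul c p _ hp =>
    obtain ⟨q, h1, h2, h3⟩ := hp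
    refine ⟨c • q, (totalDegree_smul_le _ _).trans h1, fun v => ?_, fun v hv => ?_⟩
    · simp only [smul_eval, ← h2]; ring
    · simp [h3 v hv]

end Antidifference

/-- The interior of the simplicial cone with coordinate functionals `w`. -/
def InCone {k n : ℕ} (w : Fin n → Fin k → ℤ) (u : Fin k → ℝ) : Prop := ∀ i, 0 < pairing (w i) u

/-- A small vector avoiding all hyperplanes spanned by roots. -/
structure IsGeneric {k : ℕ} (x : Fin k → ℝ) : Prop where
  sum : ∑ j, x j = 0
  ne : ∀ I : Finset (Fin k), I.Nonempty → I ≠ Finset.univ → ∑ j ∈ I, x j ≠ 0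
  lt : ∀ I : Finset (Fin k), I.Nonempty → I ≠ Finset.univ → |∑ j ∈ I, x j| < 1

/-- The lattice vector `v` perturbed by `x`. -/
def perturb {k : ℕ} (x : Fin k → ℝ) (v : Fin k → ℤ) : Fin k → ℝ := (fun j => (v j : ℝ)) + x

/-- The root attached to a pair, as a lattice vector. -/
def intRoot {k : ℕ} (p : Fin k × Fin k) : Fin k → ℤ := Pi.single p.1 1 - Pi.single p.2 1

/-- The coefficient vector of the height functional, which is positive on positive roots. -/
def height {k : ℕ} : Fin k → ℤ := fun j => -(j : ℤ)

section Perturb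

variable {k n : ℕ} {b : Fin n → Fin k × Fin k} {w : Fin n → Fin k → ℤ} {x : Fin k → ℝ}
  {v : Fin k → ℤ}

lemma sum_perturb (hx : ∑ j, x j = 0) (hv : ∑ j, v j = 0) : ∑ j, perturb x v j = 0 := by
  have : (∑ j, (v j : ℝ)) = 0 := by exact_mod_cast hv
  simp [perturb, Finset.sum_add_distrib, hx, this]

lemma cast_intRoot (p : Fin k × Fin k) : (fun j => (intRoot p j : ℝ)) = rootVec p := by
  ext j
  simp [intRoot, rootVec, Pi.single_apply]

lemma sum_intRoot (p : Fin k × Fin k) : ∑ j, intRoot p j = 0 := by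
  simp [intRoot, Finset.sum_sub_distrib]

lemma pairing_perturb (c : Fin k → ℤ) (x : Fin k → ℝ) (v : Fin k → ℤ) :
    pairing c (perturb x v) = ((∑ j, c j * v j : ℤ) : ℝ) + pairing c x := by
  rw [perturb, pairing_add, pairing_intCast]

lemma sum_mul_sub_intRoot (c v : Fin k → ℤ) (p : Fin k × Fin k) :
    ∑ j, c j * (v - intRoot p) j = ∑ j, c j * v j - (c p.1 - c p.2) := by
  simp [intRoot, mul_sub, Finset.sum_sub_distrib, Pi.single_apply]

lemma pairing_height_rootVec_pos {p : Fin k × Fin k} (hp : p.1 < p.2) :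
    0 < pairing height (rootVec p) := by
  rw [pairing_rootVec]
  have : (p.1 : ℕ) < p.2 := hp
  simp only [height]
  exact_mod_cast (by omega : (0 : ℤ) < -(p.1 : ℤ) - -(p.2 : ℤ))

lemma IsChart.pairing_ne_zero (h : IsChart b w) (hx : IsGeneric x) (i : Fin n) :
    pairing (w i) x ≠ 0 := by
  obtain ⟨I, h1, h2, h3⟩ := h.exists_sum_eq i
  rw [h3 x hx.sum]
  exact hx.ne I h1 h2

lemma IsChart.abs_pairing_lt_one (h : IsChart b w) (hx : IsGeneric x) (i : Fin n) :
    |pairing (w i) x| < 1 := by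
  obtain ⟨I, h1, h2, h3⟩ := h.exists_sum_eq i
  rw [h3 x hx.sum]
  exact hx.lt I h1 h2

/-- A coordinate of a perturbed lattice vector is positive iff the coordinate of the lattice
vector is at least `0` or `1`, according to the sign of the coordinate of the perturbation. -/
lemma IsChart.pairing_perturb_pos_iff (h : IsChart b w) (hx : IsGeneric x) (i : Fin n)
    (v : Fin k → ℤ) :
    0 < pairing (w i) (perturb x v) ↔
      1 ≤ ∑ j, w i j * v j + if 0 < pairing (w i) x then 1 else 0 := by
  rw [pairing_perturb]
  have hne := h.pairing_ne_zero hx i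
  have hlt := abs_lt.mp (h.abs_pairing_lt_one hx i)
  generalize ∑ j, w i j * v j = N at *
  split_ifs with hpos
  · constructor
    · intro h0
      have : (-1 : ℝ) < N := by linarith
      have : (-1 : ℤ) < N := by exact_mod_cast this
      omega
    · intro h0
      have : (0 : ℝ) ≤ N := by exact_mod_cast (by omega : 0 ≤ N)
      linarith
  · have hneg : pairing (w i) x < 0 := lt_of_le_of_ne (not_lt.mp hpos) hne
    constructor
    · intro h0
      have : (0 : ℝ) < N := by linarith
      have : (0 : ℤ) < N := by exact_mod_cast this
      omega
    · intro h0
      have : (1 : ℝ) ≤ N := by exact_mod_cast (by omega : 1 ≤ N)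
      linarith

lemma IsChart.pairing_perturb_ne_zero (h : IsChart b w) (hx : IsGeneric x) (i : Fin n)
    (v : Fin k → ℤ) : pairing (w i) (perturb x v) ≠ 0 := by
  rw [pairing_perturb]
  intro h0
  have hlt := h.abs_pairing_lt_one hx i
  rw [← neg_eq_of_add_eq_zero_right h0, abs_neg] at hlt
  have : |∑ j, w i j * v j| < 1 := by exact_mod_cast hlt
  rw [Int.abs_lt_one_iff] at this
  rw [this, Int.cast_zero, zero_add] at h0
  exact h.pairing_ne_zero hx i h0

lemma IsChart.exists_coeff_eq_one (h : IsChart b w) {g : Fin k × Fin k} (hg : g.1 < g.2) :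
    ∃ i, w i g.1 - w i g.2 = 1 := by
  by_contra! hne
  have hpos := pairing_height_rootVec_pos hg
  rw [h.span _ (sum_rootVec g), pairing_sum] at hpos
  refine absurd hpos (not_lt.mpr (Finset.sum_nonpos fun i _ => ?_))
  rw [pairing_smul]
  refine mul_nonpos_of_nonpos_of_nonneg ?_ (pairing_height_rootVec_pos (h.lt i)).le
  rw [pairing_rootVec]
  rcases h.coeff_cases i g with hi | hi | hi
  · rw [hi]; norm_num
  · rw [hi]; norm_num
  · exact absurd hi (hne i)

open Classical in
lemma IsChart.indicator_eq_sum (h : IsChart b w) (hx : IsGeneric x) {g : Fin k × Fin k}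
    (hg : g.1 < g.2) (v : Fin k → ℤ) :
    (if InCone w (perturb x v) then (1 : ℚ) else 0) =
      ∑ j, ((w j g.1 - w j g.2 : ℤ) : ℚ) *
        if InCone (exchangeCoeff w g j) (perturb x v) then 1 else 0 := by
  have hne : ∀ i j, i ≠ j → w i g.1 - w i g.2 ≠ 0 → w j g.1 - w j g.2 ≠ 0 →
      ((w i g.1 - w i g.2 : ℤ) : ℝ) * pairing (w i) (perturb x v) ≠
        ((w j g.1 - w j g.2 : ℤ) : ℝ) * pairing (w j) (perturb x v) := by
    intro i j hij hi hj heq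
    refine (h.exchange hg hj).pairing_perturb_ne_zero hx i v ?_
    rw [pairing_exchangeCoeff, if_neg hij, mul_assoc, ← heq, ← mul_assoc]
    rcases h.coeff_cases i g with h1 | h1 | h1
    · rw [h1]; norm_num
    · exact absurd h1 hi
    · rw [h1]; norm_num
  have key := indicator_eq_sum_exchange (fun i => pairing (w i) (perturb x v))
    (fun i => w i g.1 - w i g.2) (fun i => h.coeff_cases i g) (h.exists_coeff_eq_one hg)
    (fun i => h.pairing_perturb_ne_zero hx i v) hne
    (fun j => InCone (exchangeCoeff w g j) (perturb x v))
    (fun j _ => forall_congr' fun i => by rw [pairing_exchangeCoeff])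
  convert key
  rfl

end Perturb

section PiecewisePolynomial

open MvPolynomial

variable {k n : ℕ} {x : Fin k → ℝ}

open Classical in
/-- The function equal to the polynomial `p` on the (perturbed) cone with coordinate functionals
`w`, and to zero elsewhere. -/
noncomputable def conePoly (x : Fin k → ℝ) (w : Fin n → Fin k → ℤ) (p : MvPolynomial (Fin k) ℚ) :
    (Fin k → ℤ) → ℚ :=
  fun v => (if InCone w (perturb x v) then 1 else 0) * eval (fun j => (v j : ℚ)) p

/-- The span of the functions given by a polynomial of degree at most `d` on a simplicial cone. -/
noncomputable def piecewisePoly (n : ℕ) (x : Fin k → ℝ) (d : ℕ) :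
    Submodule ℚ ((Fin k → ℤ) → ℚ) :=
  Submodule.span ℚ {f | ∃ (b : Fin n → Fin k × Fin k) (w : Fin n → Fin k → ℤ)
    (p : MvPolynomial (Fin k) ℚ), IsChart b w ∧ p.totalDegree ≤ d ∧ f = conePoly x w p}

lemma eq_zero_of_pairing_height_neg (hx : IsGeneric x) {d : ℕ} {f : (Fin k → ℤ) → ℚ}
    (hf : f ∈ piecewisePoly n x d) {v : Fin k → ℤ} (hv : ∑ j, v j = 0)
    (hneg : pairing height (perturb x v) < 0) : f v = 0 := by
  induction hf using Submodule.span_induction with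
  | mem f hf =>
    obtain ⟨b, w, p, h, -, rfl⟩ := hf
    rw [conePoly, if_neg, zero_mul]
    intro hin
    rw [h.span _ (sum_perturb hx.sum hv), pairing_sum] at hneg
    refine absurd hneg (not_lt.mpr (Finset.sum_nonneg fun i _ => ?_))
    rw [pairing_smul]
    exact mul_nonneg (hin i).le (pairing_height_rootVec_pos (h.lt i)).le
  | zero => rfl
  | add f f' _ _ h h' => simp [h, h']
  | smul c f _ h => simp [h]

lemma IsChart.exists_conePoly_antidifference {b : Fin n → Fin k × Fin k}
    {w : Fin n → Fin k → ℤ} (h : IsChart b w) (hx : IsGeneric x) (m : Fin n) {d : ℕ}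
    {p : MvPolynomial (Fin k) ℚ} (hp : p.totalDegree ≤ d) :
    ∃ q : MvPolynomial (Fin k) ℚ, q.totalDegree ≤ d + 1 ∧
      ∀ v, conePoly x w q v - conePoly x w q (v - intRoot (b m)) = conePoly x w p v := by
  classical
  set e : ℤ := if 0 < pairing (w m) x then 1 else 0 with he
  set T : MvPolynomial (Fin k) ℚ := ∑ j, C (w m j : ℚ) * X j + C (e : ℚ) with hT
  have hTdeg : T.totalDegree ≤ 1 := by
    refine (totalDegree_add _ _).trans (max_le ?_ (by rw [totalDegree_C]; omega))
    refine totalDegree_finsetSum_le fun j _ => (totalDegree_mul _ _).trans ?_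
    rw [totalDegree_C, totalDegree_X]
  have hTint : ∀ v : Fin k → ℤ,
      eval (fun j => (v j : ℚ)) T = ((∑ j, w m j * v j + e : ℤ) : ℚ) := by
    intro v
    simp [hT]
  have hdual := h.dual m m
  rw [if_pos rfl] at hdual
  have hcast : ∀ v : Fin k → ℤ, (fun j => ((v - intRoot (b m)) j : ℚ)) =
      (fun j => (v j : ℚ)) - fun j => (intRoot (b m) j : ℚ) := by
    intro v; ext j; simp
  have hshift : ∀ v, eval (v - fun j => (intRoot (b m) j : ℚ)) T = eval v T - 1 := by
    intro v
    have : ∑ j, (w m j : ℚ) * (intRoot (b m) j : ℚ) = 1 := by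
      have h0 := sum_mul_sub_intRoot (w m) 0 (b m)
      simp only [zero_sub, Pi.neg_apply, mul_neg, Finset.sum_neg_distrib, Pi.zero_apply, mul_zero,
        Finset.sum_const_zero, neg_inj, hdual] at h0
      exact_mod_cast h0
    simp only [hT, map_add, map_sum, map_mul, eval_C, eval_X, Pi.sub_apply, mul_sub,
      Finset.sum_sub_distrib, this]
    ring
  obtain ⟨q, hq, hdiff, hzero⟩ := exists_antidifference hTdeg hshift hp
  refine ⟨q, hq, fun v => ?_⟩
  have hother : ∀ i, i ≠ m →
      (0 < pairing (w i) (perturb x (v - intRoot (b m))) ↔ 0 < pairing (w i) (perturb x v)) := by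
    intro i hi
    rw [pairing_perturb, pairing_perturb, sum_mul_sub_intRoot, h.dual, if_neg hi, sub_zero]
  have hm := h.pairing_perturb_pos_iff hx m v
  have hm' := h.pairing_perturb_pos_iff hx m (v - intRoot (b m))
  rw [sum_mul_sub_intRoot, hdual, ← he] at hm'
  rw [← he] at hm
  have hd := hdiff fun j => (v j : ℚ)
  rw [← hcast] at hd
  simp only [conePoly]
  by_cases hall : ∀ i, i ≠ m → 0 < pairing (w i) (perturb x v)
  · have h1 : InCone w (perturb x v) ↔ 1 ≤ ∑ j, w m j * v j + e := by
      rw [← hm]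
      refine ⟨fun h => h m, fun h0 i => ?_⟩
      by_cases hi : i = m
      · rwa [hi]
      · exact hall i hi
    have h2 : InCone w (perturb x (v - intRoot (b m))) ↔ 1 ≤ ∑ j, w m j * v j - 1 + e := by
      rw [← hm']
      refine ⟨fun h => h m, fun h0 i => ?_⟩
      by_cases hi : i = m
      · rwa [hi]
      · exact (hother i hi).mpr (hall i hi)
    by_cases h3 : 1 ≤ ∑ j, w m j * v j - 1 + e
    · rw [if_pos (h1.mpr (by omega)), if_pos (h2.mpr h3), one_mul, one_mul, one_mul, hd]
    · rw [if_neg (fun h => h3 (h2.mp h))]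
      by_cases h4 : 1 ≤ ∑ j, w m j * v j + e
      · rw [if_pos (h1.mpr h4), ← hd]
        rw [hzero (fun j => ((v - intRoot (b m)) j : ℚ))]
        · ring
        · rw [hTint, sum_mul_sub_intRoot, hdual]
          exact_mod_cast (by omega : ∑ j, w m j * v j - 1 + e = 0)
      · rw [if_neg (fun h => h4 (h1.mp h))]
        ring
  · rw [if_neg, if_neg]
    · ring
    · exact fun h => hall fun i hi => (hother i hi).mp (h i)
    · exact fun h => hall fun i _ => h i

/-- Summation in the direction of a positive root preserves piecewise polynomials and raises the
degree by at most one. -/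
lemma exists_piecewisePoly_antidifference (hx : IsGeneric x) {g : Fin k × Fin k}
    (hg : g.1 < g.2) {d : ℕ} {f : (Fin k → ℤ) → ℚ} (hf : f ∈ piecewisePoly n x d) :
    ∃ f' ∈ piecewisePoly n x (d + 1), ∀ v, f' v - f' (v - intRoot g) = f v := by
  classical
  induction hf using Submodule.span_induction with
  | mem f hf =>
    obtain ⟨b, w, p, h, hp, rfl⟩ := hf
    have hq : ∀ j, ∃ f' ∈ piecewisePoly n x (d + 1), w j g.1 - w j g.2 ≠ 0 →
        ∀ v, f' v - f' (v - intRoot g) = conePoly x (exchangeCoeff w g j) p v := by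
      intro j
      by_cases hj : w j g.1 - w j g.2 = 0
      · exact ⟨0, Submodule.zero_mem _, fun h => absurd hj h⟩
      · obtain ⟨q, hq, hqd⟩ := (h.exchange hg hj).exists_conePoly_antidifference hx j hp
        rw [Function.update_self] at hqd
        exact ⟨_, Submodule.subset_span ⟨_, _, q, h.exchange hg hj, hq, rfl⟩, fun _ => hqd⟩
    choose F hF hFd using hq
    refine ⟨∑ j, ((w j g.1 - w j g.2 : ℤ) : ℚ) • F j,
      Submodule.sum_mem _ fun j _ => Submodule.smul_mem _ _ (hF j), fun v => ?_⟩
    simp only [Finset.sum_apply, Pi.smul_apply, smul_eq_mul, ← Finset.sum_sub_distrib, ← mul_sub]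
    rw [conePoly, h.indicator_eq_sum hx hg v, Finset.sum_mul]
    refine Finset.sum_congr rfl fun j _ => ?_
    by_cases hj : w j g.1 - w j g.2 = 0
    · simp [hj]
    · rw [hFd j hj v, conePoly, mul_assoc]
  | zero => exact ⟨0, Submodule.zero_mem _, by simp⟩
  | add f₁ f₂ _ _ h₁ h₂ =>
    obtain ⟨f₁', hf₁, hd₁⟩ := h₁
    obtain ⟨f₂', hf₂, hd₂⟩ := h₂
    refine ⟨f₁' + f₂', Submodule.add_mem _ hf₁ hf₂, fun v => ?_⟩
    simp only [Pi.add_apply, ← hd₁, ← hd₂]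
    ring
  | smul c f _ h =>
    obtain ⟨f', hf', hd⟩ := h
    refine ⟨c • f', Submodule.smul_mem _ _ hf', fun v => ?_⟩
    simp only [Pi.smul_apply, smul_eq_mul, ← hd]
    ring

end PiecewisePolynomial

/-- The ways to write `v` as a nonnegative integer combination of the roots attached to `E`. -/
def flows {k : ℕ} (E : Finset (Fin k × Fin k)) (v : Fin k → ℤ) : Set (Fin k × Fin k → ℕ) :=
  {c | (∀ p, p ∉ E → c p = 0) ∧ ∑ p, (c p : ℤ) • intRoot p = v}

section Flows

variable {k n : ℕ} {E : Finset (Fin k × Fin k)} {v : Fin k → ℤ}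

lemma sum_mul_of_mem_flows {c : Fin k × Fin k → ℕ} (hc : c ∈ flows E v) (w : Fin k → ℤ) :
    ∑ j, w j * v j = ∑ p, (c p : ℤ) * (w p.1 - w p.2) := by
  rw [← hc.2]
  simp only [Finset.sum_apply, Pi.smul_apply, smul_eq_mul, Finset.mul_sum]
  rw [Finset.sum_comm]
  refine Finset.sum_congr rfl fun p _ => ?_
  have := sum_mul_sub_intRoot w 0 p
  simp only [zero_sub, Pi.neg_apply, mul_neg, Finset.sum_neg_distrib, Pi.zero_apply, mul_zero,
    Finset.sum_const_zero, neg_inj] at this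
  rw [← this, Finset.mul_sum]
  exact Finset.sum_congr rfl fun _ _ => by ring

lemma le_height_of_mem_flows (hE : ∀ p ∈ E, p.1 < p.2) {c : Fin k × Fin k → ℕ}
    (hc : c ∈ flows E v) (p : Fin k × Fin k) : (c p : ℤ) ≤ ∑ j, height j * v j := by
  have hterm : ∀ q, (c q : ℤ) ≤ c q * (height q.1 - height q.2) := by
    intro q
    by_cases hq : q ∈ E
    · have : (q.1 : ℕ) < q.2 := hE q hq
      exact le_mul_of_one_le_right (by positivity) (by simp only [height]; omega)
    · simp [hc.1 q hq]
  rw [sum_mul_of_mem_flows hc]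
  refine (hterm p).trans ?_
  exact Finset.single_le_sum (f := fun q => (c q : ℤ) * (height q.1 - height q.2))
    (fun q _ => le_trans (by positivity) (hterm q)) (Finset.mem_univ p)

lemma finite_flows (hE : ∀ p ∈ E, p.1 < p.2) (v : Fin k → ℤ) : (flows E v).Finite := by
  refine (Set.finite_Icc 0 fun _ => (∑ j, height j * v j).toNat).subset fun c hc => ?_
  refine ⟨fun p => Nat.zero_le _, fun p => ?_⟩
  have := le_height_of_mem_flows hE hc p
  simp only
  omega

lemma ncard_flows_eq_zero (hE : ∀ p ∈ E, p.1 < p.2) (hv : ∑ j, height j * v j < 0) :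
    (flows E v).ncard = 0 := by
  have : flows E v = ∅ := by
    refine Set.eq_empty_of_forall_notMem fun c hc => ?_
    have : 0 ≤ ∑ j, height j * v j := by
      rw [sum_mul_of_mem_flows hc]
      refine Finset.sum_nonneg fun q _ => ?_
      by_cases hq : q ∈ E
      · have : (q.1 : ℕ) < q.2 := hE q hq
        exact mul_nonneg (by positivity) (by simp only [height]; omega)
      · simp [hc.1 q hq]
    omega
  rw [this, Set.ncard_empty]

lemma ncard_flows_insert {g : Fin k × Fin k} (hE : ∀ p ∈ insert g E, p.1 < p.2) (hg : g ∉ E)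
    (v : Fin k → ℤ) :
    (flows (insert g E) v).ncard =
      (flows E v).ncard + (flows (insert g E) (v - intRoot g)).ncard := by
  have hsum : ∀ c : Fin k × Fin k → ℕ,
      ∑ p, (((c + Pi.single g 1 : Fin k × Fin k → ℕ) p : ℕ) : ℤ) • intRoot p =
        ∑ p, (c p : ℤ) • intRoot p + intRoot g := by
    intro c
    simp only [Pi.add_apply, Nat.cast_add, add_smul, Finset.sum_add_distrib]
    congr 1
    rw [Finset.sum_eq_single g] <;> simp +contextual
  have hunion : flows (insert g E) v =
      flows E v ∪ (· + Pi.single g 1) '' flows (insert g E) (v - intRoot g) := by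
    ext c
    constructor
    · intro hc
      by_cases hcg : c g = 0
      · refine Or.inl ⟨fun p hp => ?_, hc.2⟩
        by_cases hpg : p = g
        · rwa [hpg]
        · exact hc.1 p (by simp [hpg, hp])
      · have hle : Pi.single g 1 ≤ c := by
          intro p
          by_cases hpg : p = g
          · subst hpg; simp; omega
          · simp [hpg]
        refine Or.inr ⟨c - Pi.single g 1, ⟨fun p hp => ?_, ?_⟩, tsub_add_cancel_of_le hle⟩
        · simp [hc.1 p hp]
        · rw [eq_sub_iff_add_eq, ← hsum, tsub_add_cancel_of_le hle, hc.2]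
    · rintro (hc | ⟨c, hc, rfl⟩)
      · exact ⟨fun p hp => hc.1 p fun h => hp (Finset.mem_insert_of_mem h), hc.2⟩
      · refine ⟨fun p hp => ?_, ?_⟩
        · have : p ≠ g := by rintro rfl; exact hp (Finset.mem_insert_self _ _)
          simp [hc.1 p hp, this]
        · simp only
          rw [hsum, hc.2, sub_add_cancel]
  have hE' : ∀ p ∈ E, p.1 < p.2 := fun p hp => hE p (Finset.mem_insert_of_mem hp)
  rw [hunion, Set.ncard_union_eq ?_ (finite_flows hE' v) ((finite_flows hE _).image _),
    Set.ncard_image_of_injective _ (add_left_injective _)]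
  rw [Set.disjoint_left]
  rintro _ hc ⟨c, -, rfl⟩
  have := hc.1 g hg
  simp at this

lemma IsChart.ncard_flows {b : Fin n → Fin k × Fin k} {w : Fin n → Fin k → ℤ}
    (h : IsChart b w) (hv : ∑ j, v j = 0) :
    (flows (Finset.univ.image b) v).ncard = if ∀ i, 0 ≤ ∑ j, w i j * v j then 1 else 0 := by
  classical
  have hinj : Function.Injective b := by
    intro i j hij
    by_contra hne
    have h1 := h.dual i i
    have h2 := h.dual i j
    rw [← hij, if_neg hne] at h2
    rw [if_pos rfl] at h1
    omega
  have hcoord : ∀ c ∈ flows (Finset.univ.image b) v, ∀ i, (c (b i) : ℤ) = ∑ j, w i j * v j := by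
    intro c hc i
    rw [sum_mul_of_mem_flows hc, ← Finset.sum_subset (Finset.subset_univ (Finset.univ.image b)),
      Finset.sum_image fun _ _ _ _ => @hinj _ _]
    · simp [h.dual]
    · intro p _ hp
      simp [hc.1 p hp]
  split_ifs with hpos
  · rw [Set.ncard_eq_one]
    set c : Fin k × Fin k → ℕ := ∑ i, Pi.single (b i) (∑ j, w i j * v j).toNat with hc
    refine ⟨c, Set.eq_singleton_iff_unique_mem.mpr ⟨⟨fun p hp => ?_, ?_⟩, fun c' hc' => ?_⟩⟩
    · rw [hc, Finset.sum_apply]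
      refine Finset.sum_eq_zero fun i _ => ?_
      have : p ≠ b i := by rintro rfl; exact hp (by simp)
      simp [this]
    · have hspan := h.span (fun j => (v j : ℝ)) (by exact_mod_cast hv)
      have hcsum : ∑ p, (c p : ℤ) • intRoot p = ∑ i, (∑ j, w i j * v j) • intRoot (b i) := by
        simp only [hc, Finset.sum_apply, Nat.cast_sum, Finset.sum_smul]
        rw [Finset.sum_comm]
        refine Finset.sum_congr rfl fun i _ => ?_
        rw [Finset.sum_eq_single (b i)]
        · rw [Pi.single_eq_same, Int.toNat_of_nonneg (hpos i), Finset.sum_smul]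
        · intro p _ hp
          rw [Pi.single_eq_of_ne hp]; simp
        · simp
      rw [hcsum]
      ext m
      have := congrFun hspan m
      simp only [pairing_intCast, Finset.sum_apply, Pi.smul_apply, ← cast_intRoot,
        smul_eq_mul] at this ⊢
      exact_mod_cast this.symm
    · have hb : ∀ i, c (b i) = (∑ j, w i j * v j).toNat := by
        intro i
        rw [hc, Finset.sum_apply, Finset.sum_eq_single i]
        · rw [Pi.single_eq_same]
        · intro j _ hj
          rw [Pi.single_eq_of_ne (hinj.ne hj.symm)]
        · simp
      ext p
      by_cases hp : p ∈ Finset.univ.image b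
      · obtain ⟨i, -, rfl⟩ := Finset.mem_image.mp hp
        rw [hb, ← hcoord c' hc' i, Int.toNat_natCast]
      · rw [hc'.1 p hp, hc, Finset.sum_apply, eq_comm]
        refine Finset.sum_eq_zero fun i _ => ?_
        have : p ≠ b i := by rintro rfl; exact hp (by simp)
        simp [this]
  · have : flows (Finset.univ.image b) v = ∅ := by
      refine Set.eq_empty_of_forall_notMem fun c hc => hpos fun i => ?_
      rw [← hcoord c hc i]
      positivity
    rw [this, Set.ncard_empty]

/-- The number of ways to write a lattice vector as a combination of a set of positive roots that
contains a basis is piecewise polynomial. -/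
lemma IsChart.exists_piecewisePoly_eq_ncard_flows {x : Fin k → ℝ} (hx : IsGeneric x)
    {b : Fin n → Fin k × Fin k} {w : Fin n → Fin k → ℤ} (h : IsChart b w) (hin : InCone w x)
    (E : Finset (Fin k × Fin k)) (hE : ∀ p ∈ E, p.1 < p.2)
    (hdisj : ∀ p ∈ E, p ∉ Finset.univ.image b) :
    ∃ f ∈ piecewisePoly n x E.card, ∀ v : Fin k → ℤ, ∑ j, v j = 0 →
      ((flows (E ∪ Finset.univ.image b) v).ncard : ℚ) = f v := by
  classical
  induction E using Finset.induction_on with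
  | empty =>
    refine ⟨conePoly x w 1, Submodule.subset_span ⟨b, w, 1, h, by simp, rfl⟩, fun v hv => ?_⟩
    rw [Finset.empty_union, h.ncard_flows hv, conePoly, map_one, mul_one]
    have hiff : InCone w (perturb x v) ↔ ∀ i, 0 ≤ ∑ j, w i j * v j := by
      refine forall_congr' fun i => ?_
      rw [h.pairing_perturb_pos_iff hx, if_pos (hin i)]
      omega
    simp [hiff]
  | insert g E hg ih =>
    obtain ⟨f, hf, hfv⟩ := ih (fun p hp => hE p (Finset.mem_insert_of_mem hp))
      (fun p hp => hdisj p (Finset.mem_insert_of_mem hp))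
    have hglt := hE g (Finset.mem_insert_self _ _)
    obtain ⟨f', hf', hd⟩ := exists_piecewisePoly_antidifference hx hglt hf
    rw [Finset.card_insert_of_notMem hg, Finset.insert_union]
    have hgE : g ∉ E ∪ Finset.univ.image b := by
      rw [Finset.mem_union, not_or]
      exact ⟨hg, hdisj g (Finset.mem_insert_self _ _)⟩
    have hlt : ∀ p ∈ insert g (E ∪ Finset.univ.image b), p.1 < p.2 := by
      intro p hp
      rw [← Finset.insert_union, Finset.mem_union, Finset.mem_image] at hp
      rcases hp with hp | ⟨i, -, rfl⟩
      · exact hE p hp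
      · exact h.lt i
    refine ⟨f', hf', fun v hv => ?_⟩
    have hstep : ∀ N : ℕ,
        ∑ j, (v - N • intRoot g) j = 0 ∧
        ((flows (insert g (E ∪ Finset.univ.image b)) v).ncard : ℚ) - f' v =
          (flows (insert g (E ∪ Finset.univ.image b)) (v - N • intRoot g)).ncard -
            f' (v - N • intRoot g) := by
      intro N
      induction N with
      | zero => simp [hv]
      | succ N ihN =>
        obtain ⟨hs, heq⟩ := ihN
        have hsub : v - (N + 1) • intRoot g = v - N • intRoot g - intRoot g := by
          rw [add_smul, one_smul, sub_sub]
        rw [hsub]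
        refine ⟨?_, ?_⟩
        · simp only [Pi.sub_apply (v - N • intRoot g), Finset.sum_sub_distrib, sum_intRoot] at hs ⊢
          simpa using hs
        · rw [heq, ncard_flows_insert hlt hgE, Nat.cast_add, hfv _ hs,
            ← hd (v - N • intRoot g)]
          ring
    have hheight : ∀ N : ℕ, ∑ j, height j * (v - N • intRoot g) j ≤
        ∑ j, height j * v j - N := by
      intro N
      induction N with
      | zero => simp
      | succ N ihN =>
        have hsub : v - (N + 1) • intRoot g = v - N • intRoot g - intRoot g := by
          rw [add_smul, one_smul, sub_sub]
        rw [hsub, sum_mul_sub_intRoot]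
        have : (g.1 : ℕ) < g.2 := hglt
        simp only [height] at ihN ⊢
        push_cast
        linarith [(by omega : (1 : ℤ) ≤ -(g.1 : ℤ) - -(g.2 : ℤ))]
    obtain ⟨N, hN⟩ := exists_nat_gt
      (max ((∑ j, height j * v j : ℤ) : ℝ)
        (((∑ j, height j * v j : ℤ) : ℝ) + pairing height x))
    obtain ⟨hN1, hN2⟩ := max_lt_iff.mp hN
    have hb := hheight N
    have hbR : ((∑ j, height j * (v - N • intRoot g) j : ℤ) : ℝ) ≤
        ((∑ j, height j * v j : ℤ) : ℝ) - N := by exact_mod_cast hb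
    obtain ⟨hs, heq⟩ := hstep N
    rw [ncard_flows_eq_zero (v := v - N • intRoot g) hlt, eq_zero_of_pairing_height_neg hx hf' hs] at heq
    · simpa [sub_eq_zero] using heq
    · rw [pairing_perturb]
      linarith
    · have : ((∑ j, height j * v j : ℤ) : ℝ) < ((N : ℤ) : ℝ) := by exact_mod_cast hN1
      have : ∑ j, height j * v j < (N : ℤ) := by exact_mod_cast this
      omega

end Flows

section Chambers

variable {k n : ℕ}

/-- A simplicial cone whose interior contains `v + x` contains `x`, provided that `v` lies in every
simplicial cone whose interior contains `x`. -/
lemma IsChart.inCone_of_inCone_perturb {x : Fin k → ℝ} (hx : IsGeneric x)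
    {v : Fin k → ℤ} (hv : ∑ j, v j = 0)
    (hC : ∀ (b : Fin n → Fin k × Fin k) (w : Fin n → Fin k → ℤ), IsChart b w → InCone w x →
      ∀ i, 0 ≤ pairing (w i) fun j => (v j : ℝ))
    (hex : ∃ (b : Fin n → Fin k × Fin k) (w : Fin n → Fin k → ℤ), IsChart b w ∧ InCone w x)
    {b : Fin n → Fin k × Fin k} {w : Fin n → Fin k → ℤ} (h : IsChart b w)
    (hin : InCone w (perturb x v)) : InCone w x := by
  classical
  set cost : Fin k × Fin k → ℝ := fun p => if p ∈ Set.range b then 0 else 1 with hcost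
  have hcost0 : ∀ p, 0 ≤ cost p := fun p => by simp only [hcost]; split_ifs <;> norm_num
  set A : Set ℝ := {W | ∃ (b₁ : Fin n → Fin k × Fin k) (w₁ : Fin n → Fin k → ℤ),
    IsChart b₁ w₁ ∧ InCone w₁ x ∧ W = ∑ i, cost (b₁ i) * pairing (w₁ i) x} with hA
  have hfin : A.Finite := by
    refine (Set.finite_range fun q : (Fin n → Fin k × Fin k) × (Fin n → Finset (Fin k)) =>
      ∑ i, cost (q.1 i) * ∑ j ∈ q.2 i, x j).subset ?_
    rintro W ⟨b₁, w₁, h₁, -, rfl⟩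
    choose I _ _ hI using h₁.exists_sum_eq
    exact ⟨(b₁, I), by simp only [hI _ x hx.sum]⟩
  obtain ⟨b₀, w₀, h₀, hin₀⟩ := hex
  obtain ⟨W, ⟨b₁, w₁, h₁, hin₁, rfl⟩, hmin⟩ :=
    Set.exists_min_image A id hfin ⟨_, b₀, w₀, h₀, hin₀, rfl⟩
  by_cases hall : ∀ i, b₁ i ∈ Set.range b
  · intro i
    refine lt_of_le_of_ne ?_ (h.pairing_ne_zero hx i).symm
    rw [h₁.span x hx.sum, pairing_sum]
    refine Finset.sum_nonneg fun j _ => ?_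
    obtain ⟨l, hl⟩ := hall j
    rw [pairing_smul, ← hl, h.pairing_root]
    exact mul_nonneg (hin₁ j).le (by split_ifs <;> norm_num)
  exfalso
  obtain ⟨i₁, hi₁⟩ := not_forall.mp hall
  have hy : ∑ j, perturb x v j = 0 := sum_perturb hx.sum hv
  have hy₁ : ∀ i, 0 < pairing (w₁ i) (perturb x v) := by
    intro i
    rw [perturb, pairing_add]
    exact add_pos_of_nonneg_of_pos (hC b₁ w₁ h₁ hin₁ i) (hin₁ i)
  have hWy : 0 < ∑ i, cost (b₁ i) * pairing (w₁ i) (perturb x v) := by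
    refine Finset.sum_pos' (fun i _ => mul_nonneg (hcost0 _) (hy₁ i).le)
      ⟨i₁, Finset.mem_univ _, ?_⟩
    simp only [hcost, if_neg hi₁, one_mul]
    exact hy₁ i₁
  have hswap : ∑ i, cost (b₁ i) * pairing (w₁ i) (perturb x v) =
      ∑ j, pairing (w j) (perturb x v) * ∑ i, cost (b₁ i) * pairing (w₁ i) (rootVec (b j)) := by
    simp only [Finset.mul_sum]
    rw [Finset.sum_comm]
    refine Finset.sum_congr rfl fun i _ => ?_
    conv_lhs => rw [h.span _ hy, pairing_sum, Finset.mul_sum]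
    refine Finset.sum_congr rfl fun j _ => ?_
    rw [pairing_smul]; ring
  rw [hswap] at hWy
  obtain ⟨l, -, hl⟩ := Finset.exists_lt_of_sum_lt (s := Finset.univ) (f := fun _ => (0 : ℝ))
    (g := fun j => pairing (w j) (perturb x v) *
      ∑ i, cost (b₁ i) * pairing (w₁ i) (rootVec (b j)))
    (by rw [Finset.sum_const_zero]; exact hWy)
  have hred : 0 < ∑ i, cost (b₁ i) * pairing (w₁ i) (rootVec (b l)) :=
    (mul_pos_iff_of_pos_left (hin l)).mp hl
  set g := b l with hg
  have hglt : g.1 < g.2 := h.lt l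
  obtain ⟨m, hm, hmmin⟩ := Finset.exists_min_image
    (Finset.univ.filter fun i => w₁ i g.1 - w₁ i g.2 = 1) (fun i => pairing (w₁ i) x)
    (by obtain ⟨i, hi⟩ := h₁.exists_coeff_eq_one hglt; exact ⟨i, by simp [hi]⟩)
  simp only [Finset.mem_filter, Finset.mem_univ, true_and] at hm hmmin
  have h₂ := h₁.exchange hglt (m := m) (by omega)
  have hpair : ∀ i, pairing (exchangeCoeff w₁ g m i) x = if i = m then pairing (w₁ m) x else
      pairing (w₁ i) x - ((w₁ i g.1 - w₁ i g.2 : ℤ) : ℝ) * pairing (w₁ m) x := by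
    intro i
    rw [pairing_exchangeCoeff, hm]
    simp
  have hin₂ : InCone (exchangeCoeff w₁ g m) x := by
    intro i
    refine lt_of_le_of_ne ?_ (h₂.pairing_ne_zero hx i).symm
    rw [hpair]
    split_ifs with him
    · exact (hin₁ m).le
    · rcases h₁.coeff_cases i g with hi | hi | hi
      · rw [hi]; push_cast; linarith [hin₁ i, hin₁ m]
      · rw [hi]; push_cast; linarith [hin₁ i]
      · rw [hi]; push_cast; linarith [hmmin i hi]
  have hle := hmin _ ⟨_, _, h₂, hin₂, rfl⟩
  simp only [id] at hle
  have hnew : ∑ i, cost (Function.update b₁ m g i) * pairing (exchangeCoeff w₁ g m i) x =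
      ∑ i, cost (b₁ i) * pairing (w₁ i) x -
        pairing (w₁ m) x * ∑ i, cost (b₁ i) * pairing (w₁ i) (rootVec g) := by
    rw [Finset.mul_sum, ← Finset.sum_sub_distrib]
    refine Finset.sum_congr rfl fun i _ => ?_
    rw [hpair, pairing_rootVec]
    by_cases him : i = m
    · subst him
      have : cost g = 0 := by simp [hcost, hg]
      rw [if_pos rfl, Function.update_self, this, hm]
      push_cast; ring
    · rw [if_neg him, Function.update_of_ne him]
      ring
  rw [hnew] at hle
  linarith [mul_pos (hin₁ m) hred]

lemma coneOf_add_mem {S : Set (Fin k → ℝ)} {u u' : Fin k → ℝ} (hu : u ∈ coneOf S)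
    (hu' : u' ∈ coneOf S) : u + u' ∈ coneOf S := by
  obtain ⟨n, c, a, hc, ha, rfl⟩ := hu
  obtain ⟨n', c', a', hc', ha', rfl⟩ := hu'
  refine ⟨n + n', Fin.append c c', Fin.append a a', fun m => ?_, fun m => ?_, ?_⟩
  · refine Fin.addCases (fun i => ?_) (fun i => ?_) m <;> simp [hc, hc']
  · refine Fin.addCases (fun i => ?_) (fun i => ?_) m <;> simp [ha, ha']
  · simp [Fin.sum_univ_add]

lemma coneOf_smul_mem {S : Set (Fin k → ℝ)} {u : Fin k → ℝ} (hu : u ∈ coneOf S) {t : ℝ}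
    (ht : 0 ≤ t) : t • u ∈ coneOf S := by
  obtain ⟨n, c, a, hc, ha, rfl⟩ := hu
  exact ⟨n, fun m => t * c m, a, fun m => mul_nonneg ht (hc m), ha, by
    simp [Finset.smul_sum, smul_smul]⟩

lemma rootVec_mem_posRoots {p : Fin k × Fin k} (hp : p.1 < p.2) : rootVec p ∈ posRoots k :=
  ⟨p.1, p.2, hp, rfl⟩

lemma sum_eq_zero_of_mem_coneOf {S : Set (Fin k → ℝ)} (hS : S ⊆ posRoots k) {u : Fin k → ℝ}
    (hu : u ∈ coneOf S) : ∑ j, u j = 0 := by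
  obtain ⟨n, c, a, -, ha, rfl⟩ := hu
  simp only [Finset.sum_apply, Pi.smul_apply, smul_eq_mul]
  rw [Finset.sum_comm]
  refine Finset.sum_eq_zero fun m _ => ?_
  obtain ⟨i, j, -, hij⟩ := hS (ha m)
  rw [← Finset.mul_sum, hij]
  exact mul_eq_zero_of_right _ (sum_rootVec (i, j))

section Chart

variable {b : Fin n → Fin k × Fin k} {w : Fin n → Fin k → ℤ}

lemma IsChart.range_subset_posRoots (h : IsChart b w) :
    (Set.range fun i => rootVec (b i)) ⊆ posRoots k := by
  rintro _ ⟨i, rfl⟩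
  exact rootVec_mem_posRoots (h.lt i)

lemma IsChart.linearIndependent (h : IsChart b w) :
    LinearIndependent ℝ fun i => rootVec (b i) := by
  rw [Fintype.linearIndependent_iff]
  intro c hc i
  have : pairing (w i) (∑ j, c j • rootVec (b j)) = c i := by
    simp [pairing_sum, pairing_smul, h.pairing_root]
  rw [← this, hc]
  simp [pairing]

lemma IsChart.isMaxIndep (h : IsChart b w) :
    IsMaxIndep k (Set.range fun i => rootVec (b i)) := by
  refine ⟨h.range_subset_posRoots, h.linearIndependent.linearIndepOn_id, fun B' hB hB' hind => ?_⟩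
  refine eq_of_linearIndepOn_id_of_span_subtype hind hB fun u hu => ?_
  obtain ⟨i, j, -, rfl⟩ := hB' hu
  have := h.span _ (sum_rootVec (i, j))
  rw [rootVec] at this
  rw [SetLike.mem_coe, this]
  exact Submodule.sum_mem _ fun l _ => Submodule.smul_mem _ _ (Submodule.subset_span ⟨l, rfl⟩)

lemma IsChart.mem_coneOf_iff (h : IsChart b w) {u : Fin k → ℝ} :
    u ∈ coneOf (Set.range fun i => rootVec (b i)) ↔
      ∑ j, u j = 0 ∧ ∀ i, 0 ≤ pairing (w i) u := by
  constructor
  · intro hu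
    refine ⟨sum_eq_zero_of_mem_coneOf h.range_subset_posRoots hu, fun i => ?_⟩
    obtain ⟨N, c, a, hc, ha, rfl⟩ := hu
    rw [pairing_sum]
    refine Finset.sum_nonneg fun m _ => ?_
    obtain ⟨j, hj⟩ := ha m
    rw [pairing_smul, ← hj]
    refine mul_nonneg (hc m) ?_
    simp only [h.pairing_root]
    split_ifs <;> norm_num
  · rintro ⟨hu, hpos⟩
    exact ⟨n, fun i => pairing (w i) u, fun i => rootVec (b i), hpos, fun i => ⟨i, rfl⟩,
      h.span u hu⟩

end Chart

/-- The simple roots form a chart, with partial sums as coordinates. -/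
lemma isChart_simple (n : ℕ) :
    IsChart (fun i : Fin n => (i.castSucc, i.succ))
      (fun (i : Fin n) (j : Fin (n + 1)) => if j ≤ i.castSucc then 1 else 0) := by
  refine ⟨fun i => Fin.castSucc_lt_succ, fun i j => ?_, fun u hu => ?_⟩
  · simp only [Fin.le_def, Fin.val_castSucc, Fin.val_succ, Fin.ext_iff]
    split_ifs <;> omega
  · set S : ℕ → ℝ := fun l => ∑ j : Fin (n + 1), if (j : ℕ) < l then u j else 0 with hS
    have hpair : ∀ i : Fin n, pairing
        (fun j : Fin (n + 1) => if j ≤ i.castSucc then (1 : ℤ) else 0) u = S (i + 1) := by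
      intro i
      simp only [pairing, hS]
      refine Finset.sum_congr rfl fun j _ => ?_
      simp only [Fin.le_def, Fin.val_castSucc, Nat.lt_succ_iff]
      split_ifs <;> simp
    have hS0 : S 0 = 0 := by simp [hS]
    have hSn : S (n + 1) = 0 := by
      rw [← hu]
      exact Finset.sum_congr rfl fun j _ => if_pos j.isLt
    have hSstep : ∀ m : Fin (n + 1), S (m + 1) - S m = u m := by
      intro m
      simp only [hS, ← Finset.sum_sub_distrib]
      rw [Finset.sum_eq_single m]
      · simp
      · intro j _ hj
        have hne : (j : ℕ) ≠ m := fun h => hj (Fin.ext h)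
        split_ifs <;> first | omega | simp
      · simp
    ext m
    simp only [hpair, Finset.sum_apply, Pi.smul_apply, smul_eq_mul, rootVec, Pi.sub_apply, mul_sub,
      Finset.sum_sub_distrib]
    rw [← hSstep m]
    congr 1
    · refine Fin.lastCases ?_ (fun i => ?_) m
      · rw [Fin.val_last, hSn, eq_comm]
        exact Finset.sum_eq_zero fun i _ => by
          rw [Pi.single_eq_of_ne (Fin.castSucc_lt_last i).ne', mul_zero]
      · rw [Finset.sum_eq_single i]
        · simp
        · intro j _ hj
          rw [Pi.single_eq_of_ne (by simpa using hj.symm), mul_zero]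
        · simp
    · refine Fin.cases ?_ (fun i => ?_) m
      · rw [Fin.val_zero, hS0, eq_comm]
        exact Finset.sum_eq_zero fun i _ => by
          rw [Pi.single_eq_of_ne (Fin.succ_ne_zero i).symm, mul_zero]
      · rw [Finset.sum_eq_single i]
        · simp
        · intro j _ hj
          rw [Pi.single_eq_of_ne (by simpa using hj.symm), mul_zero]
        · simp

end Chambers

section Generic

open Filter Topology

variable {k : ℕ}

lemma eventually_add_mul_ne_zero {a b : ℝ} (h : a ≠ 0 ∨ b ≠ 0) :
    ∀ᶠ t in 𝓝[>] (0 : ℝ), a + t * b ≠ 0 := by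
  by_cases ha : a = 0
  · filter_upwards [self_mem_nhdsWithin] with t ht
    rw [ha, zero_add]
    exact mul_ne_zero (ne_of_gt ht) (h.resolve_left (not_not.mpr ha))
  · have hcont : ContinuousAt (fun t : ℝ => a + t * b) 0 := by fun_prop
    exact (hcont.eventually_ne (by simpa using ha)).filter_mono nhdsWithin_le_nhds

/-- A convex cone in the hyperplane of sum zero which lies in none of the hyperplanes spanned by
roots contains a generic vector near any of its elements, up to scaling. -/
lemma exists_isGeneric_mem {C : Set (Fin k → ℝ)} {x₀ : Fin k → ℝ} (hx₀ : x₀ ∈ C)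
    (hadd : ∀ u ∈ C, ∀ u' ∈ C, u + u' ∈ C) (hsmul : ∀ u ∈ C, ∀ t : ℝ, 0 ≤ t → t • u ∈ C)
    (hsum : ∀ u ∈ C, ∑ j, u j = 0)
    (hne : ∀ I : Finset (Fin k), I.Nonempty → I ≠ Finset.univ → ∃ c ∈ C, ∑ j ∈ I, c j ≠ 0) :
    ∃ x ∈ C, IsGeneric x ∧ ∀ I : Finset (Fin k), I.Nonempty → I ≠ Finset.univ →
      0 < ∑ j ∈ I, x j → 0 ≤ ∑ j ∈ I, x₀ j := by
  classical
  have hline : ∀ (u c : Fin k → ℝ) (t : ℝ) (I : Finset (Fin k)),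
      ∑ j ∈ I, (u + t • c) j = ∑ j ∈ I, u j + t * ∑ j ∈ I, c j := by
    intro u c t I
    simp [Finset.sum_add_distrib, Finset.mul_sum]
  have hz : ∀ S : Finset (Finset (Fin k)), (∀ I ∈ S, I.Nonempty ∧ I ≠ Finset.univ) →
      ∃ z ∈ C, ∀ I ∈ S, ∑ j ∈ I, z j ≠ 0 := by
    intro S
    induction S using Finset.induction_on with
    | empty => exact fun _ => ⟨x₀, hx₀, by simp⟩
    | insert I₀ S _ ih =>
      intro hS
      obtain ⟨z, hzC, hz⟩ := ih fun I hI => hS I (Finset.mem_insert_of_mem hI)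
      obtain ⟨c, hcC, hc⟩ := hne I₀ (hS I₀ (Finset.mem_insert_self _ _)).1
        (hS I₀ (Finset.mem_insert_self _ _)).2
      have hev : ∀ᶠ t in 𝓝[>] (0 : ℝ), ∀ I ∈ insert I₀ S,
          ∑ j ∈ I, z j + t * ∑ j ∈ I, c j ≠ 0 := by
        rw [Filter.eventually_all_finset]
        intro I hI
        rcases Finset.mem_insert.mp hI with rfl | hI
        · exact eventually_add_mul_ne_zero (Or.inr hc)
        · exact eventually_add_mul_ne_zero (Or.inl (hz I hI))
      obtain ⟨t, ht, ht0⟩ := (hev.and self_mem_nhdsWithin).exists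
      exact ⟨z + t • c, hadd _ hzC _ (hsmul _ hcC _ (le_of_lt ht0)), fun I hI => by
        rw [hline]; exact ht I hI⟩
  obtain ⟨z, hzC, hz⟩ := hz (Finset.univ.filter fun I => I.Nonempty ∧ I ≠ Finset.univ)
    fun I hI => (Finset.mem_filter.mp hI).2
  have hev : ∀ᶠ t in 𝓝[>] (0 : ℝ), ∀ I : Finset (Fin k), I.Nonempty → I ≠ Finset.univ →
      ∑ j ∈ I, (x₀ + t • z) j ≠ 0 ∧ (∑ j ∈ I, x₀ j < 0 → ∑ j ∈ I, (x₀ + t • z) j < 0) := by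
    rw [Filter.eventually_all]
    intro I
    by_cases hI : I.Nonempty ∧ I ≠ Finset.univ
    · have hneg : ∀ᶠ t in 𝓝[>] (0 : ℝ), ∑ j ∈ I, x₀ j < 0 →
          ∑ j ∈ I, x₀ j + t * ∑ j ∈ I, z j < 0 := by
        by_cases h0 : ∑ j ∈ I, x₀ j < 0
        · have hcont : ContinuousAt (fun t : ℝ => ∑ j ∈ I, x₀ j + t * ∑ j ∈ I, z j) 0 := by
            fun_prop
          have := hcont.eventually_lt_const (u := 0) (by simpa using h0)
          exact (this.filter_mono nhdsWithin_le_nhds).mono fun _ h _ => h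
        · exact Eventually.of_forall fun _ h => absurd h h0
      filter_upwards [hneg, eventually_add_mul_ne_zero (a := ∑ j ∈ I, x₀ j)
        (Or.inr (hz I (by simpa using hI)))] with t h1 h2 _ _
      rw [hline]
      exact ⟨h2, h1⟩
    · exact Eventually.of_forall fun _ h1 h2 => absurd ⟨h1, h2⟩ hI
  obtain ⟨t, ht, ht0⟩ := (hev.and self_mem_nhdsWithin).exists
  set y := x₀ + t • z with hy
  have hyC : y ∈ C := hadd _ hx₀ _ (hsmul _ hzC _ (le_of_lt ht0))
  have hsmall : ∀ᶠ s in 𝓝[>] (0 : ℝ), ∀ I : Finset (Fin k), |s * ∑ j ∈ I, y j| < 1 := by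
    rw [Filter.eventually_all]
    intro I
    have hcont : ContinuousAt (fun s : ℝ => |s * ∑ j ∈ I, y j|) 0 := by fun_prop
    exact (hcont.eventually_lt_const (u := 1) (by simp)).filter_mono nhdsWithin_le_nhds
  obtain ⟨s, hs, hs0⟩ := (hsmall.and self_mem_nhdsWithin).exists
  have hs0 : 0 < s := hs0
  have hscale : ∀ I : Finset (Fin k), ∑ j ∈ I, (s • y) j = s * ∑ j ∈ I, y j := fun I => by
    simp [Finset.mul_sum]
  have hsy : s • y ∈ C := hsmul _ hyC _ hs0.le
  refine ⟨s • y, hsy, ⟨hsum _ hsy, fun I h1 h2 => ?_, fun I _ _ => ?_⟩, fun I h1 h2 hpos => ?_⟩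
  · rw [hscale]
    exact mul_ne_zero hs0.ne' (ht I h1 h2).1
  · rw [hscale]
    exact hs I
  · rw [hscale, mul_pos_iff_of_pos_left hs0] at hpos
    by_contra! hlt
    exact absurd hpos (not_lt.mpr ((ht I h1 h2).2 hlt).le)

end Generic

section Kostant

variable {k n : ℕ}

lemma exists_sum_ne_zero_of_span_eq {C : Set (Fin k → ℝ)}
    (hC : Submodule.span ℝ C = Submodule.span ℝ (posRoots k)) {I : Finset (Fin k)}
    (h1 : I.Nonempty) (h2 : I ≠ Finset.univ) : ∃ c ∈ C, ∑ j ∈ I, c j ≠ 0 := by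
  classical
  by_contra! hzero
  set L : (Fin k → ℝ) →ₗ[ℝ] ℝ := ∑ j ∈ I, LinearMap.proj j with hL
  have hLapp : ∀ u, L u = ∑ j ∈ I, u j := fun u => by simp [hL]
  have hker : Submodule.span ℝ (posRoots k) ≤ LinearMap.ker L := by
    rw [← hC, Submodule.span_le]
    intro c hc
    rw [SetLike.mem_coe, LinearMap.mem_ker, hLapp, hzero c hc]
  have hroot : ∀ p : Fin k × Fin k, p.1 < p.2 → (p.1 ∈ I ↔ p.2 ∈ I) := by
    intro p hp
    have := hker (Submodule.subset_span (rootVec_mem_posRoots hp))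
    rw [LinearMap.mem_ker, hLapp] at this
    simp only [rootVec, Pi.sub_apply, Finset.sum_sub_distrib, Pi.single_apply,
      Finset.sum_ite_eq'] at this
    split_ifs at this <;> simp_all
  obtain ⟨a, ha⟩ := h1
  refine h2 (Finset.eq_univ_of_forall fun j => ?_)
  rcases lt_trichotomy a j with h | h | h
  · exact (hroot (a, j) h).mp ha
  · exact h ▸ ha
  · exact (hroot (j, a) h).mpr ha

lemma kostant_eq_ncard_flows (v : Fin k → ℤ) :
    kostant k v = (flows (Finset.univ.filter fun p : Fin k × Fin k => p.1 < p.2) v).ncard := by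
  have hnet : ∀ (c : Fin k × Fin k → ℕ) (i : Fin k), (∑ p, (c p : ℤ) • intRoot p) i =
      (∑ j, (c (i, j) : ℤ)) - ∑ j, (c (j, i) : ℤ) := by
    intro c i
    simp only [Finset.sum_apply, Pi.smul_apply, smul_eq_mul, intRoot, Pi.sub_apply, mul_sub,
      Finset.sum_sub_distrib, Fintype.sum_prod_type, Pi.single_apply, mul_ite, mul_one, mul_zero]
    congr 1
    · rw [Finset.sum_comm]
      simp
    · simp
  rw [kostant, ← Nat.card_coe_set_eq]
  refine Nat.card_congr (Equiv.subtypeEquivRight fun c => ?_)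
  simp only [flows, Set.mem_ofPred_eq, Finset.mem_filter, Finset.mem_univ, true_and, funext_iff,
    hnet]

lemma card_filter_lt_sdiff_simple (n : ℕ) :
    ((Finset.univ.filter fun p : Fin (n + 1) × Fin (n + 1) => p.1 < p.2) \
      Finset.univ.image fun i : Fin n => (i.castSucc, i.succ)).card = n.choose 2 := by
  rw [Finset.card_sdiff_of_subset, Finset.card_image_of_injective, Finset.card_univ,
    Fintype.card_fin]
  · have : (Finset.univ.filter fun p : Fin (n + 1) × Fin (n + 1) => p.1 < p.2).card =
        (n + 1).choose 2 := by
      rw [Finset.card_filter, Fintype.sum_prod_type_right]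
      simp only [← Finset.card_filter, Finset.filter_gt_eq_Iio, Fin.card_Iio]
      rw [Fin.sum_univ_eq_sum_range fun i => i, Finset.sum_range_id, Nat.choose_two_right]
    rw [this, Nat.choose_succ_succ' n 1, Nat.choose_one_right, Nat.add_sub_cancel_left]
  · intro i j hij
    exact Fin.castSucc_injective n (congrArg Prod.fst hij)
  · intro p hp
    obtain ⟨i, -, rfl⟩ := Finset.mem_image.mp hp
    simp

/-- A piecewise polynomial function agrees with a polynomial on a chamber. -/
lemma exists_eval_eq_of_mem_piecewisePoly {x : Fin k → ℝ} (hx : IsGeneric x)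
    {C : Set (Fin k → ℝ)} (hsum : ∀ u ∈ C, ∑ j, u j = 0)
    (hC : ∀ (b : Fin n → Fin k × Fin k) (w : Fin n → Fin k → ℤ), IsChart b w → InCone w x →
      ∀ u ∈ C, ∀ i, 0 ≤ pairing (w i) u)
    (hex : ∃ (b : Fin n → Fin k × Fin k) (w : Fin n → Fin k → ℤ), IsChart b w ∧ InCone w x)
    {d : ℕ} {f : (Fin k → ℤ) → ℚ} (hf : f ∈ piecewisePoly n x d) :
    ∃ q : MvPolynomial (Fin k) ℚ, q.totalDegree ≤ d ∧
      ∀ v : Fin k → ℤ, (fun j => (v j : ℝ)) ∈ C →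
        f v = MvPolynomial.eval (fun j => (v j : ℚ)) q := by
  induction hf using Submodule.span_induction with
  | mem f hf =>
    obtain ⟨b, w, p, h, hp, rfl⟩ := hf
    by_cases hin : InCone w x
    · refine ⟨p, hp, fun v hv => ?_⟩
      rw [conePoly, if_pos, one_mul]
      intro i
      rw [perturb, pairing_add]
      exact add_pos_of_nonneg_of_pos (hC b w h hin _ hv i) (hin i)
    · refine ⟨0, by simp, fun v hv => ?_⟩
      rw [conePoly, if_neg, zero_mul, map_zero]
      refine fun hin' => hin (h.inCone_of_inCone_perturb hx ?_
        (fun b w h hin => hC b w h hin _ hv) hex hin')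
      exact_mod_cast hsum _ hv
  | zero => exact ⟨0, by simp, by simp⟩
  | add f f' _ _ h h' =>
    obtain ⟨q, hq, hv⟩ := h
    obtain ⟨q', hq', hv'⟩ := h'
    exact ⟨q + q', (MvPolynomial.totalDegree_add _ _).trans (max_le hq hq'), fun v hC => by
      rw [Pi.add_apply, hv v hC, hv' v hC, map_add]⟩
  | smul c f _ h =>
    obtain ⟨q, hq, hv⟩ := h
    exact ⟨c • q, (MvPolynomial.totalDegree_smul_le _ _).trans hq, fun v hC => by
      rw [Pi.smul_apply, hv v hC, MvPolynomial.smul_eval, smul_eq_mul]⟩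

end Kostant

/-- On the lattice points of any chamber `C` of the chamber complex of `cone(Δ+)`, the
Kostant partition function agrees with a polynomial in `v = (v_1, …, v_k)` of (total)
degree at most `(k-1).choose 2`. -/
theorem stmt2 (k : ℕ) (hk : 0 < k) (C : Set (Fin k → ℝ)) (hC : IsChamber k C) :
    ∃ p : MvPolynomial (Fin k) ℚ, p.totalDegree ≤ (k - 1).choose 2 ∧
      ∀ v : Fin k → ℤ, (fun i => (v i : ℝ)) ∈ C →
        (kostant k v : ℚ) = MvPolynomial.eval (fun i => (v i : ℚ)) p := by
  obtain ⟨n, rfl⟩ := Nat.exists_eq_succ_of_ne_zero hk.ne'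
  obtain ⟨⟨x₀, hx₀, hCeq⟩, hspan⟩ := hC
  have hsimple := isChart_simple n
  have hle : ∀ (b : Fin n → Fin (n + 1) × Fin (n + 1)) (w : Fin n → Fin (n + 1) → ℤ),
      IsChart b w → (∀ i, 0 ≤ pairing (w i) x₀) →
        ∀ u ∈ C, ∑ j, u j = 0 ∧ ∀ i, 0 ≤ pairing (w i) u := by
    intro b w h hpos u hu
    rw [hCeq] at hu
    exact h.mem_coneOf_iff.mp (hu _ ⟨_, h.isMaxIndep, h.mem_coneOf_iff.mpr
      ⟨sum_eq_zero_of_mem_coneOf subset_rfl hx₀, hpos⟩, rfl⟩)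
  have hsub := hle _ _ hsimple fun i => by
    obtain ⟨N, c, a, hc, ha, rfl⟩ := hx₀
    rw [pairing_sum]
    refine Finset.sum_nonneg fun m _ => ?_
    rw [pairing_smul]
    obtain ⟨p, q, hpq, hm⟩ := ha m
    rw [hm]
    refine mul_nonneg (hc m) ?_
    have := pairing_rootVec
      (fun j : Fin (n + 1) => if j ≤ i.castSucc then (1 : ℤ) else 0) (p, q)
    rw [rootVec] at this
    rw [this, Int.cast_nonneg_iff]
    simp only
    split_ifs <;> omega
  have hx₀C : x₀ ∈ C := by
    rw [hCeq]
    rintro _ ⟨B, -, hB, rfl⟩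
    exact hB
  obtain ⟨x, hxC, hx, hxx₀⟩ := exists_isGeneric_mem hx₀C
    (fun u hu u' hu' => by
      rw [hCeq] at hu hu' ⊢
      rintro _ ⟨B, hB, hxB, rfl⟩
      exact coneOf_add_mem (hu _ ⟨B, hB, hxB, rfl⟩) (hu' _ ⟨B, hB, hxB, rfl⟩))
    (fun u hu t ht => by
      rw [hCeq] at hu ⊢
      rintro _ ⟨B, hB, hxB, rfl⟩
      exact coneOf_smul_mem (hu _ ⟨B, hB, hxB, rfl⟩) ht)
    (fun u hu => (hsub u hu).1)
    (fun I h1 h2 => exists_sum_ne_zero_of_span_eq hspan h1 h2)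
  have hin : InCone (fun (i : Fin n) (j : Fin (n + 1)) => if j ≤ i.castSucc then (1 : ℤ) else 0)
      x := fun i => lt_of_le_of_ne ((hsub x hxC).2 i) (hsimple.pairing_ne_zero hx i).symm
  set E := (Finset.univ.filter fun p : Fin (n + 1) × Fin (n + 1) => p.1 < p.2) \
    Finset.univ.image fun i : Fin n => (i.castSucc, i.succ) with hE
  obtain ⟨f, hf, hflow⟩ := hsimple.exists_piecewisePoly_eq_ncard_flows hx hin E
    (fun p hp => by simp only [hE, Finset.mem_sdiff, Finset.mem_filter] at hp; exact hp.1.2)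
    (fun p hp => (Finset.mem_sdiff.mp hp).2)
  rw [hE, card_filter_lt_sdiff_simple] at hf
  obtain ⟨q, hq, hfq⟩ := exists_eval_eq_of_mem_piecewisePoly hx (fun u hu => (hsub u hu).1)
    (fun b w h hinw u hu => by
      refine (hle b w h (fun i => ?_) u hu).2
      obtain ⟨I, h1, h2, h3⟩ := h.exists_sum_eq i
      rw [h3 _ (hsub _ hx₀C).1]
      refine hxx₀ I h1 h2 ?_
      rw [← h3 _ hx.sum]
      exact hinw i)
    ⟨_, _, hsimple, hin⟩ hf
  refine ⟨q, hq, fun v hv => ?_⟩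
  rw [← hfq v hv, ← hflow v (by exact_mod_cast (hsub _ hv).1), kostant_eq_ncard_flows, hE,
    Finset.sdiff_union_of_subset]
  intro p hp
  obtain ⟨i, -, rfl⟩ := Finset.mem_image.mp hp
  simp
end
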